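/- Let Δ be a non-𝕜-orientable 𝕜-homology manifold and R = 𝕜[Δ]. Then tr(ω_R) ⊇ 𝔐², where 𝔐 is the graded maximal ideal of R. -/

import Mathlib

/-! # Preliminaries

Self-contained definitions: simplicial complexes, simplicial homology, Stanley–Reisner rings,
canonical modules, canonical traces, and the various Gorenstein-type conditions. -/

open CategoryTheory

/-- An abstract simplicial complex on the vertex set `Fin n` (the empty set is a face). -/
structure SC (n : ℕ) where
  faces : Finset (Finset (Fin n))
  empty_mem : ∅ ∈ faces
  down_closed : ∀ {σ τ : Finset (Fin n)}, σ ∈ faces → τ ⊆ σ → τ ∈ faces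

namespace SC

variable {n : ℕ} (Δ : SC n)

/-- The dimension of a simplicial complex, as an integer (the complex `{∅}` has
dimension `-1`). -/
def dim : ℤ := ((Δ.faces.sup Finset.card : ℕ) : ℤ) - 1

/-- `v` is a vertex of `Δ`. -/
def IsVertex (v : Fin n) : Prop := {v} ∈ Δ.faces

/-- A facet is a face which is maximal by inclusion. -/
def IsFacet (σ : Finset (Fin n)) : Prop :=
  σ ∈ Δ.faces ∧ ∀ τ ∈ Δ.faces, σ ⊆ τ → σ = τ

/-- A cone point is a vertex contained in every facet. -/
def IsConePoint (v : Fin n) : Prop :=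
  Δ.IsVertex v ∧ ∀ σ, Δ.IsFacet σ → v ∈ σ

/-- A simplicial complex is connected if it has a vertex and any two vertices are joined
by a path of edges. -/
def Connected : Prop :=
  (∃ v, Δ.IsVertex v) ∧ ∀ u v, Δ.IsVertex u → Δ.IsVertex v →
    Relation.ReflTransGen (fun a b => ({a, b} : Finset (Fin n)) ∈ Δ.faces) u v

/-- A simplicial complex is strongly connected if any two facets are joined by a chain of
facets in which consecutive facets intersect in a face of dimension `dim Δ - 1`. -/
def StronglyConnected : Prop :=
  ∀ σ τ, Δ.IsFacet σ → Δ.IsFacet τ →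
    Relation.ReflTransGen
      (fun α β => Δ.IsFacet α ∧ Δ.IsFacet β ∧ ((α ∩ β).card : ℤ) - 1 = Δ.dim - 1) σ τ

/-- A pseudomanifold: strongly connected, and every face of dimension `dim Δ - 1` is
contained in exactly two facets. -/
def IsPseudomanifold : Prop :=
  Δ.StronglyConnected ∧
    ∀ τ ∈ Δ.faces, (τ.card : ℤ) - 1 = Δ.dim - 1 →
      {σ : Finset (Fin n) | Δ.IsFacet σ ∧ τ ⊆ σ}.ncard = 2

/-- The link of a face `σ` of `Δ`. -/
def link (σ : Finset (Fin n)) (hσ : σ ∈ Δ.faces) : SC n where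
  faces := Δ.faces.filter fun τ => τ ∩ σ = ∅ ∧ τ ∪ σ ∈ Δ.faces
  empty_mem := by
    simp only [Finset.mem_filter]
    exact ⟨Δ.empty_mem, by simp, by simpa using hσ⟩
  down_closed := by
    intro σ' τ' h hsub
    simp only [Finset.mem_filter] at h ⊢
    refine ⟨Δ.down_closed h.1 hsub, ?_, ?_⟩
    · have := h.2.1
      rw [Finset.eq_empty_iff_forall_notMem] at this ⊢
      intro x hx
      exact this x (Finset.mem_inter.mpr
        ⟨hsub (Finset.mem_inter.mp hx).1, (Finset.mem_inter.mp hx).2⟩)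
    · exact Δ.down_closed h.2.2 (Finset.union_subset_union hsub (le_refl σ))

/-- A complex is normal if the link of every face of dimension `≤ dim Δ - 2` is connected. -/
def Normal : Prop :=
  ∀ σ (hσ : σ ∈ Δ.faces), (σ.card : ℤ) - 1 ≤ Δ.dim - 2 → (Δ.link σ hσ).Connected

/-! ## Simplicial homology -/

/-- Faces of `Δ` of cardinality `c` containing the face `σ`.  These index a basis of the
`c`-th chain group of the pair `(Δ, cost_Δ σ)` (for `σ = ∅` this is the augmented
(reduced) chain complex of `Δ`, since the empty face is included in chain degree `0`). -/
def RFace (σ : Finset (Fin n)) (c : ℕ) : Type :=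
  {τ : Finset (Fin n) // τ ∈ Δ.faces ∧ σ ⊆ τ ∧ τ.card = c}

instance (σ : Finset (Fin n)) (c : ℕ) : Fintype (Δ.RFace σ c) :=
  inferInstanceAs (Fintype {τ : Finset (Fin n) // τ ∈ Δ.faces ∧ σ ⊆ τ ∧ τ.card = c})

instance (σ : Finset (Fin n)) (c : ℕ) : DecidableEq (Δ.RFace σ c) :=
  inferInstanceAs (DecidableEq {τ : Finset (Fin n) // τ ∈ Δ.faces ∧ σ ⊆ τ ∧ τ.card = c})

variable (R : Type) [CommRing R]

/-- Chains of the pair `(Δ, cost_Δ σ)` with coefficients in `R`. -/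
abbrev relChain (σ : Finset (Fin n)) (c : ℕ) : Type := Δ.RFace σ c → R

/-- The matrix of the simplicial boundary map of the pair `(Δ, cost_Δ σ)`: the coefficient of
`ρ` in `∂ τ` is `(-1)^j` if `ρ` is obtained from `τ` by deleting its `(j+1)`-st vertex (the
deleted vertex not belonging to `σ`), and `0` otherwise. -/
def relBMat (σ : Finset (Fin n)) (i : ℕ) :
    Matrix (Δ.RFace σ i) (Δ.RFace σ (i + 1)) R :=
  fun ρ τ => ∑ v ∈ τ.1, if v ∉ σ ∧ τ.1.erase v = ρ.1
    then (-1 : R) ^ ((τ.1.filter (fun w => w < v)).card) else 0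

/-- The boundary map of the chain complex of the pair `(Δ, cost_Δ σ)`. -/
noncomputable def relBoundary (σ : Finset (Fin n)) (i : ℕ) :
    Δ.relChain R σ (i + 1) →ₗ[R] Δ.relChain R σ i :=
  (Δ.relBMat R σ i).mulVecLin

/-- The relative simplicial homology `H_d(Δ, cost_Δ σ; R)` (`d ≥ 0`). -/
noncomputable def relHomology (σ : Finset (Fin n)) (d : ℕ) : Type :=
  LinearMap.ker (Δ.relBoundary R σ d) ⧸
    Submodule.comap (LinearMap.ker (Δ.relBoundary R σ d)).subtype
      (LinearMap.range (Δ.relBoundary R σ (d + 1)))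

noncomputable instance (σ : Finset (Fin n)) (d : ℕ) : AddCommGroup (Δ.relHomology R σ d) :=
  inferInstanceAs (AddCommGroup (LinearMap.ker (Δ.relBoundary R σ d) ⧸
    Submodule.comap (LinearMap.ker (Δ.relBoundary R σ d)).subtype
      (LinearMap.range (Δ.relBoundary R σ (d + 1)))))

noncomputable instance (σ : Finset (Fin n)) (d : ℕ) : Module R (Δ.relHomology R σ d) :=
  inferInstanceAs (Module R (LinearMap.ker (Δ.relBoundary R σ d) ⧸
    Submodule.comap (LinearMap.ker (Δ.relBoundary R σ d)).subtype
      (LinearMap.range (Δ.relBoundary R σ (d + 1)))))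

/-- Reduced simplicial homology `H̃_d(Δ; R)` for `d ≥ 0`: the homology of the augmented chain
complex, i.e. of the pair `(Δ, cost_Δ ∅)`. -/
noncomputable abbrev reducedHomology (d : ℕ) : Type := Δ.relHomology R ∅ d

/-- Reduced simplicial homology in degree `-1`. -/
noncomputable def reducedHomologyNeg : Type :=
  (⊤ : Submodule R (Δ.relChain R ∅ 0)) ⧸
    Submodule.comap (⊤ : Submodule R (Δ.relChain R ∅ 0)).subtype
      (LinearMap.range (Δ.relBoundary R ∅ 0))

noncomputable instance : AddCommGroup (Δ.reducedHomologyNeg R) :=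
  inferInstanceAs (AddCommGroup ((⊤ : Submodule R (Δ.relChain R ∅ 0)) ⧸
    Submodule.comap (⊤ : Submodule R (Δ.relChain R ∅ 0)).subtype
      (LinearMap.range (Δ.relBoundary R ∅ 0))))

noncomputable instance : Module R (Δ.reducedHomologyNeg R) :=
  inferInstanceAs (Module R ((⊤ : Submodule R (Δ.relChain R ∅ 0)) ⧸
    Submodule.comap (⊤ : Submodule R (Δ.relChain R ∅ 0)).subtype
      (LinearMap.range (Δ.relBoundary R ∅ 0))))

/-- Cycles of the non-augmented chain complex of `Δ` in dimension `d` (for `d = 0` every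
`0`-chain is a cycle). -/
noncomputable def cyclesUnred (d : ℕ) : Submodule R (Δ.relChain R ∅ (d + 1)) :=
  if d = 0 then ⊤ else LinearMap.ker (Δ.relBoundary R ∅ d)

/-- (Unreduced) simplicial homology `H_d(Δ; R)`. -/
noncomputable def homologyUnred (d : ℕ) : Type :=
  Δ.cyclesUnred R d ⧸
    Submodule.comap (Δ.cyclesUnred R d).subtype (LinearMap.range (Δ.relBoundary R ∅ (d + 1)))

noncomputable instance (d : ℕ) : AddCommGroup (Δ.homologyUnred R d) :=
  inferInstanceAs (AddCommGroup (Δ.cyclesUnred R d ⧸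
    Submodule.comap (Δ.cyclesUnred R d).subtype (LinearMap.range (Δ.relBoundary R ∅ (d + 1)))))

noncomputable instance (d : ℕ) : Module R (Δ.homologyUnred R d) :=
  inferInstanceAs (Module R (Δ.cyclesUnred R d ⧸
    Submodule.comap (Δ.cyclesUnred R d).subtype (LinearMap.range (Δ.relBoundary R ∅ (d + 1)))))

/-- `Δ` is `R`-orientable if `H_d(Δ; R) ≠ 0`, where `d = dim Δ`. -/
def Orientable : Prop :=
  ∃ d : ℕ, Δ.dim = (d : ℤ) ∧ Nontrivial (Δ.homologyUnred R d)

/-- A `k`-homology sphere condition for a single complex `Γ`: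
`H̃_i(Γ; k) = k` for `i = dim Γ` and `0` otherwise. -/
def HomologySphereCond (Γ : SC n) : Prop :=
  (∀ i : ℕ, ((i : ℤ) = Γ.dim → Nonempty ((Γ.reducedHomology R i) ≃ₗ[R] R)) ∧
    ((i : ℤ) ≠ Γ.dim → Subsingleton (Γ.reducedHomology R i))) ∧
  ((-1 : ℤ) = Γ.dim → Nonempty ((Γ.reducedHomologyNeg R) ≃ₗ[R] R)) ∧
  ((-1 : ℤ) ≠ Γ.dim → Subsingleton (Γ.reducedHomologyNeg R))

/-- `Δ` is a `k`-homology manifold: it is connected and the link of every nonempty face has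
the reduced homology of a sphere of its dimension. -/
def IsHomologyManifold : Prop :=
  Δ.Connected ∧ ∀ σ (hσ : σ ∈ Δ.faces), σ ≠ ∅ → HomologySphereCond R (Δ.link σ hσ)

/-- `Δ` is isomorphic to the disjoint union of `m` vertices. -/
def IsDisjointVertices (m : ℕ) : Prop :=
  ∃ v : Fin m → Fin n, Function.Injective v ∧
    ∀ σ : Finset (Fin n), σ ∈ Δ.faces ↔ (σ = ∅ ∨ ∃ i, σ = {v i})

/-- `Δ` is isomorphic to a path of length `m` (with `m` edges and `m+1` vertices). -/
def IsPathComplex (m : ℕ) : Prop :=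
  ∃ v : Fin (m + 1) → Fin n, Function.Injective v ∧
    ∀ σ : Finset (Fin n), σ ∈ Δ.faces ↔
      (σ = ∅ ∨ (∃ i, σ = {v i}) ∨ ∃ i : Fin m, σ = {v i.castSucc, v i.succ})

end SC

/-! ## Commutative algebra -/

/-- The `i`-th Ext module `Ext^i_R(M, N)` of two `R`-modules, as an object of `ModuleCat R`. -/
noncomputable def extMod (R : Type) [CommRing R] (M N : Type) [AddCommGroup M] [Module R M]
    [AddCommGroup N] [Module R N] (i : ℕ) : ModuleCat R :=
  ((Ext R (ModuleCat R) i).obj (Opposite.op (ModuleCat.of R M))).obj (ModuleCat.of R N)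

/-- The trace ideal of an `R`-module `M`: the sum of the images of all `R`-linear maps
`M → R`. -/
noncomputable def traceIdeal (R : Type) [CommRing R] (M : Type) [AddCommGroup M] [Module R M] :
    Ideal R :=
  ⨆ f : M →ₗ[R] R, LinearMap.range f

/-- A Noetherian ring `R` with a distinguished maximal ideal `𝔪` (a local ring, or a graded
ring with its graded maximal ideal) is Cohen--Macaulay when `depth = dim`, i.e. (by the
Ext-characterisation of depth) `Ext^i_R(R/𝔪, R) = 0` for all `i < dim R`. -/
def IsCohenMacaulayAt (R : Type) [CommRing R] (𝔪 : Ideal R) : Prop :=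
  IsNoetherianRing R ∧
    ∀ i : ℕ, (i : WithBot (WithTop ℕ)) < ringKrullDim R → Subsingleton (extMod R (R ⧸ 𝔪) R i)

/-- A Noetherian ring `R` with a distinguished maximal ideal `𝔪` (a local ring, or a graded
ring with its graded maximal ideal) is Gorenstein when `Ext^i_R(R/𝔪, R)` vanishes for
`i ≠ dim R` and is isomorphic to `R/𝔪` for `i = dim R`. -/
def IsGorensteinAt (R : Type) [CommRing R] (𝔪 : Ideal R) : Prop :=
  IsNoetherianRing R ∧
    ∀ i : ℕ, ((i : WithBot (WithTop ℕ)) = ringKrullDim R →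
        Nonempty ((extMod R (R ⧸ 𝔪) R i) ≃ₗ[R] (R ⧸ 𝔪))) ∧
      ((i : WithBot (WithTop ℕ)) ≠ ringKrullDim R → Subsingleton (extMod R (R ⧸ 𝔪) R i))

/-- A Noetherian local ring is Gorenstein. -/
def IsGorensteinLocalRing (A : Type) [CommRing A] [IsLocalRing A] : Prop :=
  IsGorensteinAt A (IsLocalRing.maximalIdeal A)

section Graded

variable (k : Type) [Field k] {n : ℕ}

/-- An ideal of a polynomial ring is homogeneous (graded) if it contains all homogeneous
components of its elements. -/
def IsHomogIdeal (I : Ideal (MvPolynomial (Fin n) k)) : Prop :=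
  ∀ p ∈ I, ∀ d : ℕ, MvPolynomial.homogeneousComponent d p ∈ I

/-- The graded (irrelevant) maximal ideal of `k[x_1,…,x_n]/I`, generated by the images of the
variables. -/
noncomputable def quotMax (I : Ideal (MvPolynomial (Fin n) k)) :
    Ideal (MvPolynomial (Fin n) k ⧸ I) :=
  Ideal.span (Set.range fun i : Fin n => Ideal.Quotient.mk I (MvPolynomial.X i))

/-- The degree `j` component of the standard graded ring `k[x_1,…,x_n]/I`, as a
`k`-subspace. -/
noncomputable def quotGrade (I : Ideal (MvPolynomial (Fin n) k)) (j : ℕ) :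
    Submodule k (MvPolynomial (Fin n) k ⧸ I) :=
  (MvPolynomial.homogeneousSubmodule (Fin n) k j).map (Ideal.Quotient.mkₐ k I).toLinearMap

/-- The `ℤ^n`-graded component of `k[x_1,…,x_n]/I` of multidegree `a`: the `k`-line spanned by
the image of the monomial `x^a`. -/
noncomputable def quotMonomialGrade (I : Ideal (MvPolynomial (Fin n) k)) (a : Fin n → ℕ) :
    Submodule k (MvPolynomial (Fin n) k ⧸ I) :=
  Submodule.span k
    {Ideal.Quotient.mk I (MvPolynomial.monomial (Finsupp.equivFunOnFinite.symm a) (1 : k))}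

/-- The standard graded ring `R = k[x_1,…,x_n]/I` is Gorenstein on the punctured spectrum if
`R_𝔭` is Gorenstein for every graded prime `𝔭` other than the graded maximal ideal. -/
def GorensteinPunctured (I : Ideal (MvPolynomial (Fin n) k)) : Prop :=
  ∀ (𝔭 : Ideal (MvPolynomial (Fin n) k ⧸ I)) [𝔭.IsPrime],
    IsHomogIdeal k (𝔭.comap (Ideal.Quotient.mk I)) → 𝔭 ≠ quotMax k I →
      IsGorensteinLocalRing (Localization.AtPrime 𝔭)

/-- `ω` is a canonical module of the standard graded ring `R = k[x_1,…,x_n]/I`, `d = dim R`,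
when `ω ≅ Ext^{n-d}_S(R, S)` for `S = k[x_1,…,x_n]` (by graded local duality this is, up to
shift, the Matlis dual of the top local cohomology module `H^d_𝔪(R)`). -/
def IsCanonicalModuleQ (I : Ideal (MvPolynomial (Fin n) k)) (ω : Type) [AddCommGroup ω]
    [Module (MvPolynomial (Fin n) k ⧸ I) ω] : Prop :=
  Module.Finite (MvPolynomial (Fin n) k ⧸ I) ω ∧
    ∃ d : ℕ, ringKrullDim (MvPolynomial (Fin n) k ⧸ I) = (d : WithBot (WithTop ℕ)) ∧
      letI : Module (MvPolynomial (Fin n) k) ω := Module.compHom ω (Ideal.Quotient.mk I)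
      Nonempty (ω ≃ₗ[MvPolynomial (Fin n) k]
        (extMod (MvPolynomial (Fin n) k) (MvPolynomial (Fin n) k ⧸ I)
          (MvPolynomial (Fin n) k) (n - d)))

/-- A `ℤ`-grading on a module `ω` over `R = k[x_1,…,x_n]/I` compatible with the standard
grading of `R`. -/
def IsCompatibleGrading (I : Ideal (MvPolynomial (Fin n) k)) (ω : Type) [AddCommGroup ω]
    [Module (MvPolynomial (Fin n) k ⧸ I) ω] [Module k ω] (gr : ℤ → Submodule k ω) : Prop :=
  DirectSum.IsInternal gr ∧
    ∀ (i : ℕ) (j : ℤ) (r : MvPolynomial (Fin n) k ⧸ I) (m : ω),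
      r ∈ quotGrade k I i → m ∈ gr j → r • m ∈ gr ((i : ℤ) + j)

/-- The minimal number of generators of a module `M` over `R = k[…]/I` with graded maximal
ideal `𝔪`: the `k`-dimension of `M/𝔪M`. -/
noncomputable def muGen (R : Type) [CommRing R] [Algebra k R] (𝔪 : Ideal R) (M : Type)
    [AddCommGroup M] [Module R M] : ℕ :=
  letI : Module k (M ⧸ (𝔪 • (⊤ : Submodule R M))) :=
    Module.compHom (M ⧸ (𝔪 • (⊤ : Submodule R M))) (algebraMap k R)
  Module.finrank k (M ⧸ (𝔪 • (⊤ : Submodule R M)))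

/-- The Hilbert--Samuel function `j ↦ dim_k M/𝔪^j M` of a module. -/
noncomputable def hilbSam (R : Type) [CommRing R] [Algebra k R] (𝔪 : Ideal R) (M : Type)
    [AddCommGroup M] [Module R M] (j : ℕ) : ℕ :=
  letI : Module k (M ⧸ ((𝔪 ^ j) • (⊤ : Submodule R M))) :=
    Module.compHom (M ⧸ ((𝔪 ^ j) • (⊤ : Submodule R M))) (algebraMap k R)
  Module.finrank k (M ⧸ ((𝔪 ^ j) • (⊤ : Submodule R M)))

/-- `M` is an Ulrich module with respect to `𝔪`: its minimal number of generators `μ(M)`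
equals its multiplicity `e(𝔪; M) = lim_j t!·dim_k(M/𝔪^j M)/j^t`, where `t = dim M`. -/
def IsUlrich (R : Type) [CommRing R] [Algebra k R] (𝔪 : Ideal R) (M : Type) [AddCommGroup M]
    [Module R M] : Prop :=
  ∃ t : ℕ, ringKrullDim (R ⧸ Module.annihilator R M) = (t : WithBot (WithTop ℕ)) ∧
    Filter.Tendsto
      (fun j : ℕ => ((t.factorial : ℝ) * (hilbSam k R 𝔪 M j : ℝ)) / (j : ℝ) ^ t)
      Filter.atTop (nhds ((muGen k R 𝔪 M : ℝ)))

end Graded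

section SR

variable (k : Type) [Field k] {n : ℕ}

/-- The Stanley--Reisner ideal of `Δ`: generated by the squarefree monomials supported on
non-faces of `Δ`. -/
noncomputable def srIdeal (Δ : SC n) : Ideal (MvPolynomial (Fin n) k) :=
  Ideal.span {m | ∃ σ : Finset (Fin n), σ ∉ Δ.faces ∧ m = ∏ i ∈ σ, MvPolynomial.X i}

/-- The Stanley--Reisner ring `k[Δ]`. -/
abbrev SRRing (Δ : SC n) : Type := MvPolynomial (Fin n) k ⧸ srIdeal k Δ

/-- The graded maximal ideal of `k[Δ]`. -/
noncomputable abbrev srMax (Δ : SC n) : Ideal (SRRing k Δ) := quotMax k (srIdeal k Δ)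

/-- The value at `j` of the Hilbert function of the (canonically graded) canonical module of
`k[Δ]`, as computed by Gräbe's theorem:
`dim_k [ω]_j = Σ_{a ∈ ℕ^n, |a| = j} dim_k H_{dim Δ}(Δ, cost_Δ(supp a); k)`. -/
noncomputable def canonicalHilbert (Δ : SC n) (j : ℕ) : ℕ :=
  ∑ a ∈ (Fintype.piFinset fun _ : Fin n => Finset.range (j + 1)).filter
      (fun a => ∑ i, a i = j),
    Module.finrank k
      (Δ.relHomology k (Finset.univ.filter fun i => a i ≠ 0) (Δ.faces.sup Finset.card - 1))

/-- A `ℤ`-grading `gr` on a module `ω` over `k[Δ]` is the canonical grading of the canonical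
module if it is a compatible grading, is supported in nonnegative degrees, and its Hilbert
function is the one given by Gräbe's theorem. -/
def IsCanonicallyGraded (Δ : SC n) (ω : Type) [AddCommGroup ω] [Module (SRRing k Δ) ω]
    [Module k ω] (gr : ℤ → Submodule k ω) : Prop :=
  IsCompatibleGrading k (srIdeal k Δ) ω gr ∧ (∀ j : ℤ, j < 0 → gr j = ⊥) ∧
    ∀ j : ℕ, Module.finrank k (gr (j : ℤ)) = canonicalHilbert k Δ j

/-- A `ℤ^n`-grading `grN` on a module `ω` over `k[Δ]` (supported in `ℕ^n`) is the canonical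
multigrading of the canonical module if it is an internal direct sum, is compatible with the
`ℤ^n`-grading of `k[Δ]`, and its multigraded Hilbert function is the one given by Gräbe's
theorem: `dim_k [ω]_a = dim_k H_{dim Δ}(Δ, cost_Δ(supp a); k)`. -/
def IsCanonicallyMultiGraded (Δ : SC n) (ω : Type) [AddCommGroup ω] [Module (SRRing k Δ) ω]
    [Module k ω] (grN : (Fin n → ℕ) → Submodule k ω) : Prop :=
  DirectSum.IsInternal grN ∧
    (∀ (a b : Fin n → ℕ) (r : SRRing k Δ) (m : ω),
      r ∈ quotMonomialGrade k (srIdeal k Δ) a → m ∈ grN b → r • m ∈ grN (a + b)) ∧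
    ∀ a : Fin n → ℕ, Module.finrank k (grN a) =
      Module.finrank k
        (Δ.relHomology k (Finset.univ.filter fun i => a i ≠ 0) (Δ.faces.sup Finset.card - 1))

end SR

/-- The chain map `C_•(Δ, cost_Δ τ) → C_•(Δ, cost_Δ σ)` (for `τ ⊆ σ`) induced by the
inclusion `cost_Δ τ ⊆ cost_Δ σ`: basis faces not containing `σ` are sent to `0`. -/
def SC.relChainMap {n : ℕ} (Δ : SC n) (R : Type) [CommRing R] (τ σ : Finset (Fin n)) (c : ℕ) :
    Δ.relChain R τ c →ₗ[R] Δ.relChain R σ c :=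
  Matrix.mulVecLin (fun (β : Δ.RFace σ c) (α : Δ.RFace τ c) => if α.1 = β.1 then (1 : R) else 0)

set_option synthInstance.maxHeartbeats 1000000 in
/-- `R = k[x_1,…,x_n]/I` is almost Gorenstein with respect to a canonical module `ω` with
(canonical) grading `gr`: writing `a = a_R` for the `a`-invariant (so `-a` is the least degree
of `ω`), there is an injective degree-zero `R`-linear map `φ : R → ω(-a)` whose cokernel is
zero or an Ulrich module. -/
def IsAlmostGorenstein (k : Type) [Field k] {n : ℕ} (I : Ideal (MvPolynomial (Fin n) k))
    (ω : Type) [AddCommGroup ω] [Module (MvPolynomial (Fin n) k ⧸ I) ω] [Module k ω]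
    (gr : ℤ → Submodule k ω) : Prop :=
  ∃ a : ℤ, (gr (-a) ≠ ⊥ ∧ ∀ j : ℤ, j < -a → gr j = ⊥) ∧
    ∃ φ : (MvPolynomial (Fin n) k ⧸ I) →ₗ[MvPolynomial (Fin n) k ⧸ I] ω,
      Function.Injective φ ∧
      (∀ (i : ℕ) (r : MvPolynomial (Fin n) k ⧸ I),
        r ∈ quotGrade k I i → φ r ∈ gr ((i : ℤ) - a)) ∧
      (Subsingleton (ω ⧸ LinearMap.range φ) ∨
        IsUlrich k (MvPolynomial (Fin n) k ⧸ I) (quotMax k I) (ω ⧸ LinearMap.range φ))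


section ExtLemmas

universe u
variable {A : Type} [CommRing A]

/-- functoriality of `linearYonedaObj` in the module -/
noncomputable def yoMap (P : ChainComplex (ModuleCat.{0} A) ℕ) {Y Y' : ModuleCat.{0} A} (f : Y ⟶ Y') :
    P.linearYonedaObj A Y ⟶ P.linearYonedaObj A Y' where
  f i := ModuleCat.ofHom (Linear.rightComp A (P.X i) f)
  comm' i j _ := by
    ext x
    simp only [ChainComplex.linearYonedaObj_d]
    change P.d j i ≫ ((x : P.X i ⟶ Y) ≫ f) = (P.d j i ≫ (x : P.X i ⟶ Y)) ≫ f
    exact (Category.assoc _ _ _).symm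

theorem yo_exactAt (P : ChainComplex (ModuleCat.{0} A) ℕ) (Y : ModuleCat.{0} A) (i : ℕ)
    (h : ∀ f : P.X i ⟶ Y, P.d (i+1) i ≫ f = 0 → ∃ g : P.X ((ComplexShape.up ℕ).prev i) ⟶ Y,
        P.d i ((ComplexShape.up ℕ).prev i) ≫ g = f) :
    Limits.IsZero ((P.linearYonedaObj A Y).homology i) := by
  rw [← HomologicalComplex.exactAt_iff_isZero_homology,
    HomologicalComplex.exactAt_iff' _ ((ComplexShape.up ℕ).prev i) i (i+1) rfl (by simp)]
  rw [ShortComplex.moduleCat_exact_iff]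
  intro x hx
  obtain ⟨g, hg⟩ := h x hx
  exact ⟨g, hg⟩

theorem extMod_iso_yo (M N : Type) [AddCommGroup M] [Module A M] [AddCommGroup N] [Module A N]
    (P : ProjectiveResolution (ModuleCat.of A M)) (i : ℕ) :
    Nonempty (extMod A M N i ≅ (P.complex.linearYonedaObj A (ModuleCat.of A N)).homology i) :=
  ⟨P.isoExt i _⟩

theorem extMod_isZero (M N : Type) [AddCommGroup M] [Module A M] [AddCommGroup N] [Module A N]
    {ι : Type} (s : Finset ι) (r : ι → A) (ψ : ι → N →ₗ[A] N)
    (hM : ∀ t, ∀ m : M, r t • m = 0) (hN : ∀ x, ∑ t ∈ s, r t • ψ t x = x)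
    (P : ProjectiveResolution (ModuleCat.of A M)) (i : ℕ) :
    Limits.IsZero ((P.complex.linearYonedaObj A (ModuleCat.of A N)).homology i) := by
  let h : ∀ t, Homotopy (r t • 𝟙 P.complex) 0 := fun t => P.liftHomotopyZero (f := r t • 𝟙 P.complex) (by
    ext x
    change (P.π.f 0).hom (r t • x) = 0
    rw [map_smul]
    exact hM _ _)
  apply yo_exactAt
  intro f hf
  have key : ∀ t, ∀ f : P.complex.X i ⟶ ModuleCat.of A N, P.complex.d (i+1) i ≫ f = 0 →
      ∃ g : P.complex.X ((ComplexShape.up ℕ).prev i) ⟶ ModuleCat.of A N,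
        P.complex.d i ((ComplexShape.up ℕ).prev i) ≫ g = r t • f := by
    intro t f hf
    have hc := (h t).comm i
    simp only [HomologicalComplex.zero_f, add_zero, HomologicalComplex.smul_f_apply,
      HomologicalComplex.id_f] at hc
    have h2 : r t • f = dNext i (h t).hom ≫ f := by
      have : (r t • 𝟙 (P.complex.X i)) ≫ f = (dNext i (h t).hom + prevD i (h t).hom) ≫ f := by rw [← hc]
      rw [Linear.smul_comp, Category.id_comp, Preadditive.add_comp] at this
      rw [this]
      have : prevD i (h t).hom ≫ f = 0 := by
        rw [prevD_eq (j := i) (j' := i+1) (h t).hom (by simp), Category.assoc, hf, Limits.comp_zero]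
      rw [this, add_zero]
    rw [h2]
    cases i with
    | zero =>
      refine ⟨0, ?_⟩
      have : dNext 0 (h t).hom = 0 := by
        dsimp only [dNext]
        change P.complex.d 0 ((ComplexShape.down ℕ).next 0) ≫ _ = 0
        rw [P.complex.shape _ _ (by simp), Limits.zero_comp]
      rw [this]; simp
    | succ j =>
      have hp : (ComplexShape.up ℕ).prev (j+1) = j := by simp
      rw [hp]
      refine ⟨(h t).hom j (j+1) ≫ f, ?_⟩
      rw [dNext_eq (i := j+1) (i' := j) (h t).hom (by simp)]
      simp
  have key2 : ∀ t, ∃ g : P.complex.X ((ComplexShape.up ℕ).prev i) ⟶ ModuleCat.of A N,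
        P.complex.d i ((ComplexShape.up ℕ).prev i) ≫ g = r t • (f ≫ ModuleCat.ofHom (ψ t)) := by
    intro t
    apply key
    rw [← Category.assoc, hf, Limits.zero_comp]
  choose g hg using key2
  refine ⟨∑ t ∈ s, g t, ?_⟩
  rw [Preadditive.comp_sum, Finset.sum_congr rfl (fun t _ => hg t)]
  ext x
  rw [ModuleCat.hom_sum, LinearMap.sum_apply]
  exact hN (f.hom x)

theorem extMod_shift (M : Type) [AddCommGroup M] [Module A M]
    (X Y Z : Type) [AddCommGroup X] [Module A X] [AddCommGroup Y] [Module A Y] [AddCommGroup Z] [Module A Z]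
    (f : X →ₗ[A] Y) (g : Y →ₗ[A] Z) (hf : Function.Injective f) (hg : Function.Surjective g)
    (hfg : Function.Exact f g)
    (P : ProjectiveResolution (ModuleCat.of A M))
    (h0 : ∀ i, Limits.IsZero ((P.complex.linearYonedaObj A (ModuleCat.of A Y)).homology i)) (i : ℕ) :
    Nonempty ((P.complex.linearYonedaObj A (ModuleCat.of A Z)).homology i ≅
      (P.complex.linearYonedaObj A (ModuleCat.of A X)).homology (i+1)) := by
  let S : ShortComplex (CochainComplex (ModuleCat.{0} A) ℕ) :=
    ShortComplex.mk (yoMap P.complex (ModuleCat.ofHom f)) (yoMap P.complex (ModuleCat.ofHom g)) (by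
      ext i x
      change ((x : P.complex.X i ⟶ ModuleCat.of A X) ≫ ModuleCat.ofHom f) ≫ ModuleCat.ofHom g = 0
      ext y
      exact hfg.apply_apply_eq_zero _)
  have hS : S.ShortExact := by
    apply HomologicalComplex.shortExact_of_degreewise_shortExact
    intro j
    refine { exact := ?_, mono_f := ?_, epi_g := ?_ }
    · rw [ShortComplex.moduleCat_exact_iff]
      intro x hx
      change P.complex.X j ⟶ ModuleCat.of A Y at x
      change x ≫ ModuleCat.ofHom g = 0 at hx
      have hx' : ∀ t, ∃ s, f s = x.hom t := by
        intro t
        have : g (x.hom t) = 0 := congrArg (fun q => q.hom t) hx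
        exact (hfg _).1 this
      choose s hs using hx'
      refine ⟨ModuleCat.ofHom
        { toFun := s, map_add' := fun a b => hf (by simp [hs]),
          map_smul' := fun a b => hf (by simp [hs]) }, ?_⟩
      change _ ≫ ModuleCat.ofHom f = x
      ext t
      exact hs t
    · rw [ModuleCat.mono_iff_injective]
      intro a b hab
      change P.complex.X j ⟶ ModuleCat.of A X at a b
      change a ≫ ModuleCat.ofHom f = b ≫ ModuleCat.ofHom f at hab
      exact ModuleCat.hom_ext (LinearMap.ext fun t => hf (congrArg (fun q => q.hom t) hab))
    · rw [ModuleCat.epi_iff_surjective]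
      intro b
      change P.complex.X j ⟶ ModuleCat.of A Z at b
      have : Epi (ModuleCat.ofHom g) := (ModuleCat.epi_iff_surjective _).2 hg
      exact ⟨Projective.factorThru b (ModuleCat.ofHom g), Projective.factorThru_comp b (ModuleCat.ofHom g)⟩
  exact ⟨hS.δIso i (i+1) (by simp) (h0 i) (h0 (i+1))⟩

/-- evaluation from `H^0` -/
theorem extMod_zero (M N : Type) [AddCommGroup M] [Module A M] [AddCommGroup N] [Module A N]
    (P : ProjectiveResolution (ModuleCat.of A M)) :
    Nonempty ((P.complex.linearYonedaObj A (ModuleCat.of A N)).homology 0 ≃ₗ[A] (M →ₗ[A] N)) := by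
  let K := P.complex.linearYonedaObj A (ModuleCat.of A N)
  let i1 : K.homology 0 ≅ K.cycles 0 := (CochainComplex.isoHomologyπ₀ K).symm
  let i2 : K.cycles 0 ≅ ModuleCat.of A (LinearMap.ker (K.sc 0).g.hom) := (K.sc 0).moduleCatCyclesIso
  have hz : ∀ j, P.complex.d j 0 ≫ P.π.f 0 = 0 := by
    intro j
    rw [← P.π.comm j 0]
    exact Limits.comp_zero
  let Ψ : (M →ₗ[A] N) →ₗ[A] LinearMap.ker (K.sc 0).g.hom :=
    { toFun := fun φ => ⟨(show P.complex.X 0 ⟶ ModuleCat.of A N from P.π.f 0 ≫ ModuleCat.ofHom φ), by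
        change P.complex.d _ 0 ≫ P.π.f 0 ≫ (ModuleCat.ofHom φ : ModuleCat.of A M ⟶ ModuleCat.of A N) = 0
        exact (Category.assoc _ _ _).symm.trans ((congrArg (· ≫ _) (hz _)).trans Limits.zero_comp)⟩
      map_add' := fun a b => rfl
      map_smul' := fun a b => by
        apply Subtype.ext
        change P.π.f 0 ≫ ModuleCat.ofHom (a • b) = a • (P.π.f 0 ≫ ModuleCat.ofHom b)
        ext x
        rfl }
  have hinj : Function.Injective Ψ := by
    intro a b hab
    have h1 : P.π.f 0 ≫ ModuleCat.ofHom a = P.π.f 0 ≫ ModuleCat.ofHom b := congrArg Subtype.val hab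
    have h2 : ModuleCat.ofHom a = ModuleCat.ofHom b := (cancel_epi (P.π.f 0)).1 h1
    exact congrArg ModuleCat.Hom.hom h2
  have hsurj : Function.Surjective Ψ := by
    rintro ⟨f, hf⟩
    change P.complex.X 0 ⟶ ModuleCat.of A N at f
    have hf' := hf
    change P.complex.d ((ComplexShape.up ℕ).next 0) 0 ≫ f = 0 at hf'
    have h1 : (ComplexShape.up ℕ).next 0 = 1 := by simp
    rw [h1] at hf'
    obtain ⟨l, hl⟩ := Limits.CokernelCofork.IsColimit.desc' P.isColimitCokernelCofork f hf'
    refine ⟨ModuleCat.Hom.hom (show ModuleCat.of A M ⟶ ModuleCat.of A N from l), Subtype.ext ?_⟩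
    exact hl
  exact ⟨(i1 ≪≫ i2).toLinearEquiv.trans (LinearEquiv.ofBijective Ψ ⟨hinj, hsurj⟩).symm⟩

theorem yo_congr (X Y : Type) [AddCommGroup X] [Module A X] [AddCommGroup Y] [Module A Y]
    (e : X ≃ₗ[A] Y) (P : ChainComplex (ModuleCat.{0} A) ℕ) (i : ℕ) :
    Nonempty ((P.linearYonedaObj A (ModuleCat.of A X)).homology i ≅
      (P.linearYonedaObj A (ModuleCat.of A Y)).homology i) := by
  refine ⟨(HomologicalComplex.homologyFunctor _ _ i).mapIso
    ⟨yoMap P e.toModuleIso.hom, yoMap P e.toModuleIso.inv, ?_, ?_⟩⟩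
  · ext j x
    change ((x : P.X j ⟶ ModuleCat.of A X) ≫ e.toModuleIso.hom) ≫ e.toModuleIso.inv = x
    exact (Category.assoc _ _ _).trans ((congrArg (_ ≫ ·) (Iso.hom_inv_id _)).trans (Category.comp_id _))
  · ext j x
    change ((x : P.X j ⟶ ModuleCat.of A Y) ≫ e.toModuleIso.inv) ≫ e.toModuleIso.hom = x
    exact (Category.assoc _ _ _).trans ((congrArg (_ ≫ ·) (Iso.inv_hom_id _)).trans (Category.comp_id _))

/-- If `0 → X → Z n`, with `Z (j+1) → C (j+1) → Z j` short exact and each `C j` (`m < j ≤ n`)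
killed by Ext from `M`, then `Ext^{n-m}(M, Z n) = Hom(M, Z m)`. -/
theorem extMod_chain (M : Type) [AddCommGroup M] [Module A M] (X : Type) [AddCommGroup X] [Module A X]
    (Z C : ℕ → Type) [∀ j, AddCommGroup (Z j)] [∀ j, Module A (Z j)]
    [∀ j, AddCommGroup (C j)] [∀ j, Module A (C j)] (n m : ℕ) (hmn : m ≤ n)
    (e : X ≃ₗ[A] Z n)
    (f : ∀ j, Z j →ₗ[A] C j) (g : ∀ j, C (j+1) →ₗ[A] Z j)
    (hf : ∀ j, Function.Injective (f j)) (hg : ∀ j, j < n → Function.Surjective (g j))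
    (hfg : ∀ j, Function.Exact (f (j+1)) (g j))
    (hC : ∀ j, m < j → ∃ (ι : Type) (s : Finset ι) (r : ι → A) (ψ : ι → C j →ₗ[A] C j),
      (∀ t, ∀ x : M, r t • x = 0) ∧ ∀ x, ∑ t ∈ s, r t • ψ t x = x) :
    Nonempty (extMod A M X (n - m) ≃ₗ[A] (M →ₗ[A] Z m)) := by
  let P : ProjectiveResolution (ModuleCat.of A M) := projectiveResolution _
  obtain ⟨i1⟩ := extMod_iso_yo M X P (n - m)
  obtain ⟨i2⟩ := yo_congr X (Z n) e P.complex (n - m)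
  obtain ⟨i3⟩ := extMod_zero M (Z m) P
  have key : ∀ t, t ≤ n - m → Nonempty ((P.complex.linearYonedaObj A (ModuleCat.of A (Z m))).homology 0 ≅
      (P.complex.linearYonedaObj A (ModuleCat.of A (Z (m+t)))).homology t) := by
    intro t
    induction t with
    | zero => intro _; exact ⟨Iso.refl _⟩
    | succ t ih =>
      intro ht
      obtain ⟨a⟩ := ih (by omega)
      obtain ⟨ι, s, r, ψ, hr1, hr2⟩ := hC (m+t+1) (by omega)
      obtain ⟨b⟩ := extMod_shift M _ _ _ (f (m+t+1)) (g (m+t)) (hf _) (hg _ (by omega)) (hfg _) P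
        (fun i => extMod_isZero M _ s r ψ hr1 hr2 P i) t
      exact ⟨a ≪≫ b⟩
  obtain ⟨i4⟩ := key (n - m) le_rfl
  rw [Nat.add_sub_cancel' hmn] at i4
  exact ⟨((i1 ≪≫ i2) ≪≫ i4.symm).toLinearEquiv.trans i3⟩

end ExtLemmas


section Cousin

/-- Laurent polynomials -/
def Lau (k : Type) [Field k] (n : ℕ) : Type := AddMonoidAlgebra k (Fin n → ℤ)

variable (k : Type) [Field k] (n : ℕ)

noncomputable instance : CommRing (Lau k n) := inferInstanceAs (CommRing (AddMonoidAlgebra k (Fin n → ℤ)))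

/-- basic Laurent monomials -/
noncomputable def Lau.mon (a : Fin n → ℤ) (c : k) : Lau k n := AddMonoidAlgebra.single a c

/-- coefficients -/
noncomputable def Lau.cf (a : Fin n → ℤ) : Lau k n →+ k where
  toFun f := AddMonoidAlgebra.coeff f a
  map_zero' := rfl
  map_add' _ _ := rfl

variable {k n}

theorem Lau.ext' {f g : Lau k n} (h : ∀ a, Lau.cf k n a f = Lau.cf k n a g) : f = g := by
  apply AddMonoidAlgebra.coeff_injective
  ext a
  exact h a

theorem Lau.cf_mon_mul (a b : Fin n → ℤ) (c : k) (f : Lau k n) :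
    Lau.cf k n a (Lau.mon k n b c * f) = c * Lau.cf k n (a - b) f := by
  have := AddMonoidAlgebra.coeff_single_mul_apply (f : AddMonoidAlgebra k (Fin n → ℤ)) c b a
  rw [sub_eq_neg_add]
  exact this

theorem Lau.cf_mon (a b : Fin n → ℤ) (c : k) :
    Lau.cf k n a (Lau.mon k n b c) = if a = b then c else 0 := by
  change (Finsupp.single b c) a = _
  rw [Finsupp.single_apply]
  simp [eq_comm]

theorem Lau.exists_of (c : (Fin n → ℤ) →₀ k) : ∃ f : Lau k n, ∀ a, Lau.cf k n a f = c a :=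
  ⟨AddMonoidAlgebra.ofCoeff c, fun _ => rfl⟩

theorem Lau.finite_supp (f : Lau k n) : {a | Lau.cf k n a f ≠ 0}.Finite :=
  (AddMonoidAlgebra.coeff f).hasFiniteSupport

variable (k n)
/-- constants -/
noncomputable def Lau.cst : k →+* Lau k n :=
  AddMonoidAlgebra.singleZeroRingHom

/-- polynomials to Laurent polynomials -/
noncomputable def toLau : MvPolynomial (Fin n) k →+* Lau k n :=
  MvPolynomial.eval₂Hom (Lau.cst k n) (fun i => Lau.mon k n (Pi.single i 1) 1)

noncomputable instance : Algebra (MvPolynomial (Fin n) k) (Lau k n) := (toLau k n).toAlgebra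

variable {k n}

theorem Lau.cf_C_smul (a : Fin n → ℤ) (c : k) (f : Lau k n) :
    Lau.cf k n a (MvPolynomial.C (σ := Fin n) c • f) = c * Lau.cf k n a f := by
  have h : MvPolynomial.C (σ := Fin n) c • f = Lau.mon k n 0 c * f := by
    change toLau k n (MvPolynomial.C c) * f = _
    rw [toLau, MvPolynomial.eval₂Hom_C]; rfl
  rw [h, Lau.cf_mon_mul, sub_zero]

theorem Lau.cf_X_smul (a : Fin n → ℤ) (i : Fin n) (f : Lau k n) :
    Lau.cf k n a (MvPolynomial.X (R := k) i • f) = Lau.cf k n (a - Pi.single i 1) f := by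
  have h : MvPolynomial.X (R := k) i • f = Lau.mon k n (Pi.single i 1) 1 * f := by
    change toLau k n (MvPolynomial.X i) * f = _
    rw [toLau, MvPolynomial.eval₂Hom_X']
  rw [h, Lau.cf_mon_mul, one_mul]

/-- building linear maps -/
theorem exists_lin {M N : Type} [AddCommGroup M] [AddCommGroup N] [Module (MvPolynomial (Fin n) k) M]
    [Module (MvPolynomial (Fin n) k) N] (f : M → N) (hadd : ∀ x y, f (x + y) = f x + f y)
    (hC : ∀ (c : k) y, f (MvPolynomial.C (σ := Fin n) c • y) = MvPolynomial.C (σ := Fin n) c • f y)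
    (hX : ∀ (i : Fin n) y, f (MvPolynomial.X (R := k) i • y) = MvPolynomial.X (R := k) i • f y) :
    ∃ g : M →ₗ[MvPolynomial (Fin n) k] N, ∀ y, g y = f y := by
  refine ⟨⟨⟨f, hadd⟩, ?_⟩, fun _ => rfl⟩
  intro p
  change ∀ x, f (p • x) = p • f x
  induction p using MvPolynomial.induction_on with
  | C c => exact hC c
  | add p q hp hq => intro x; rw [add_smul, hadd, hp, hq, add_smul]
  | mul_X p i hp => intro x; rw [mul_smul, hp, hX, mul_smul]

/-- good degrees -/
def goodDeg (F : Finset (Fin n)) (a : Fin n → ℤ) : Prop := ∀ i, i ∉ F → a i < 0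

instance (F : Finset (Fin n)) (a : Fin n → ℤ) : Decidable (goodDeg F a) :=
  inferInstanceAs (Decidable (∀ i, i ∉ F → a i < 0))

theorem goodDeg.sub {F : Finset (Fin n)} {a : Fin n → ℤ} (h : goodDeg F a) (i : Fin n) :
    goodDeg F (a - Pi.single i 1) := by
  intro j hj
  have := h j hj
  by_cases hij : j = i
  · subst hij; simp; omega
  · simp [hij]; omega

theorem goodDeg.mono {F G : Finset (Fin n)} {a : Fin n → ℤ} (h : goodDeg F a) (hs : F ⊆ G) :
    goodDeg G a := fun i hi => h i (fun h' => hi (hs h'))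

variable (k n)

/-- submodule of irrelevant parts -/
noncomputable def cB : Submodule (MvPolynomial (Fin n) k) (Finset (Fin n) → Lau k n) where
  carrier := {q | ∀ F a, goodDeg F a → Lau.cf k n a (q F) = 0}
  zero_mem' := by intro F a _; exact map_zero _
  add_mem' := by
    intro x y hx hy F a h
    have h1 := hx F a h
    have h2 := hy F a h
    rw [Pi.add_apply, map_add, h1, h2, add_zero]
  smul_mem' := by
    intro p
    change ∀ x : Finset (Fin n) → Lau k n, (∀ F a, goodDeg F a → Lau.cf k n a (x F) = 0) → (∀ F a, goodDeg F a → Lau.cf k n a (p • x F) = 0)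
    intro x hx F
    induction p using MvPolynomial.induction_on with
    | C c => intro a h; rw [Lau.cf_C_smul, hx F a h, mul_zero]
    | add p q hp hq => intro a h; rw [add_smul, map_add, hp a h, hq a h, add_zero]
    | mul_X p i hp =>
      intro a h
      rw [mul_comm, mul_smul, Lau.cf_X_smul]
      exact hp _ (h.sub i)

/-- the total Cousin module -/
abbrev cQ : Type := (Finset (Fin n) → Lau k n) ⧸ cB k n

variable {k n}

/-- coefficient on tuple -/
noncomputable def cfT (F : Finset (Fin n)) (a : Fin n → ℤ) : (Finset (Fin n) → Lau k n) →+ k where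
  toFun q := if goodDeg F a then Lau.cf k n a (q F) else 0
  map_zero' := by simp
  map_add' x y := by split_ifs <;> simp

/-- coefficient on quotient -/
noncomputable def cfQ (F : Finset (Fin n)) (a : Fin n → ℤ) : cQ k n →+ k :=
  QuotientAddGroup.lift (cB k n).toAddSubgroup (cfT F a) (by
    intro x hx
    change (if goodDeg F a then Lau.cf k n a (x F) else 0) = 0
    split_ifs with h
    · exact hx F a h
    · rfl)

theorem cfQ_mk (F : Finset (Fin n)) (a : Fin n → ℤ) (q : Finset (Fin n) → Lau k n) :
    cfQ F a (Submodule.Quotient.mk (p := cB k n) q) = if goodDeg F a then Lau.cf k n a (q F) else 0 := rfl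

theorem cfQ_bad {F : Finset (Fin n)} {a : Fin n → ℤ} (h : ¬ goodDeg F a) (y : cQ k n) : cfQ F a y = 0 := by
  obtain ⟨q, rfl⟩ := Submodule.Quotient.mk_surjective _ y
  rw [cfQ_mk, if_neg h]

theorem cQ_ext {x y : cQ k n} (h : ∀ F a, goodDeg F a → cfQ F a x = cfQ F a y) : x = y := by
  obtain ⟨q, rfl⟩ := Submodule.Quotient.mk_surjective _ x
  obtain ⟨r, rfl⟩ := Submodule.Quotient.mk_surjective _ y
  rw [Submodule.Quotient.eq]
  intro F a hg
  have := h F a hg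
  rw [cfQ_mk, cfQ_mk, if_pos hg, if_pos hg] at this
  rw [Pi.sub_apply, map_sub, this, sub_self]

theorem cfQ_C (F : Finset (Fin n)) (a : Fin n → ℤ) (c : k) (y : cQ k n) :
    cfQ F a (MvPolynomial.C (σ := Fin n) c • y) = c * cfQ F a y := by
  obtain ⟨q, rfl⟩ := Submodule.Quotient.mk_surjective _ y
  rw [← Submodule.Quotient.mk_smul, cfQ_mk, cfQ_mk]
  split_ifs
  · exact Lau.cf_C_smul a c (q F)
  · simp

theorem cfQ_X (F : Finset (Fin n)) (a : Fin n → ℤ) (i : Fin n) (y : cQ k n) :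
    cfQ F a (MvPolynomial.X (R := k) i • y) = if goodDeg F a then cfQ F (a - Pi.single i 1) y else 0 := by
  obtain ⟨q, rfl⟩ := Submodule.Quotient.mk_surjective _ y
  rw [← Submodule.Quotient.mk_smul, cfQ_mk, cfQ_mk]
  split_ifs with h h2
  · exact Lau.cf_X_smul a i (q F)
  · exact absurd (h.sub i) h2
  · rfl

theorem cQ_exists (c : Finset (Fin n) → (Fin n → ℤ) →₀ k) :
    ∃ y : cQ k n, ∀ F a, cfQ F a y = if goodDeg F a then c F a else 0 := by
  choose f hf using fun F => Lau.exists_of (c F)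
  refine ⟨Submodule.Quotient.mk f, fun F a => ?_⟩
  rw [cfQ_mk, hf]

theorem cQ_exists' (c : Finset (Fin n) → (Fin n → ℤ) → k)
    (hc : ∀ F, {a | c F a ≠ 0}.Finite) (hg : ∀ F a, ¬ goodDeg F a → c F a = 0) :
    ∃ y : cQ k n, ∀ F a, cfQ F a y = c F a := by
  obtain ⟨y, hy⟩ := cQ_exists (fun F => Finsupp.ofSupportFinite (c F) (hc F))
  refine ⟨y, fun F a => ?_⟩
  rw [hy]
  split_ifs with h
  · rfl
  · exact (hg F a h).symm

theorem cQ_finite (y : cQ k n) (F : Finset (Fin n)) : {a | cfQ F a y ≠ 0}.Finite := by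
  obtain ⟨q, rfl⟩ := Submodule.Quotient.mk_surjective _ y
  refine (Lau.finite_supp (q F)).subset ?_
  intro a ha h0
  apply ha
  rw [cfQ_mk, h0]; simp

/-- sign -/
def sgn (k : Type) [Field k] (F : Finset (Fin n)) (v : Fin n) : k := (-1 : k) ^ ((F.filter (fun w => w < v)).card)

/-- Cousin differential -/
noncomputable def cDT (k : Type) [Field k] (n : ℕ) : (Finset (Fin n) → Lau k n) →ₗ[MvPolynomial (Fin n) k] (Finset (Fin n) → Lau k n) :=
  LinearMap.pi fun G => ∑ v ∈ Finset.univ.filter (fun v => v ∉ G),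
    MvPolynomial.C (σ := Fin n) (sgn k (insert v G) v) • (LinearMap.proj (insert v G) : (Finset (Fin n) → Lau k n) →ₗ[MvPolynomial (Fin n) k] Lau k n)

theorem cDT_apply (q : Finset (Fin n) → Lau k n) (G : Finset (Fin n)) (a : Fin n → ℤ) :
    Lau.cf k n a (cDT k n q G) = ∑ v ∈ Finset.univ.filter (fun v => v ∉ G),
      sgn k (insert v G) v * Lau.cf k n a (q (insert v G)) := by
  have : cDT k n q G = ∑ v ∈ Finset.univ.filter (fun v => v ∉ G),
    MvPolynomial.C (σ := Fin n) (sgn k (insert v G) v) • q (insert v G) := by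
    simp [cDT]
  rw [this, map_sum]
  exact Finset.sum_congr rfl fun v _ => Lau.cf_C_smul _ _ _

/-- Cousin differential on the quotient -/
noncomputable def cD (k : Type) [Field k] (n : ℕ) : cQ k n →ₗ[MvPolynomial (Fin n) k] cQ k n :=
  Submodule.mapQ _ _ (cDT k n) (by
    intro q hq G a h
    rw [cDT_apply]
    refine Finset.sum_eq_zero fun v _ => ?_
    rw [hq (insert v G) a (h.mono (Finset.subset_insert _ _)), mul_zero])

theorem cfQ_D (G : Finset (Fin n)) (a : Fin n → ℤ) (y : cQ k n) :
    cfQ G a (cD k n y) = if goodDeg G a then ∑ v ∈ Finset.univ.filter (fun v => v ∉ G),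
      sgn k (insert v G) v * cfQ (insert v G) a y else 0 := by
  obtain ⟨q, rfl⟩ := Submodule.Quotient.mk_surjective _ y
  have : cD k n (Submodule.Quotient.mk q) = Submodule.Quotient.mk (cDT k n q) := rfl
  rw [this, cfQ_mk]
  split_ifs with h
  · rw [cDT_apply]
    refine Finset.sum_congr rfl fun v _ => ?_
    rw [cfQ_mk, if_pos (h.mono (Finset.subset_insert _ _))]
  · rfl

variable (k n)
/-- component of the Cousin complex -/
noncomputable def cQm (m : ℕ) : Submodule (MvPolynomial (Fin n) k) (cQ k n) where
  carrier := {y | ∀ F a, F.card ≠ m → cfQ F a y = 0}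
  zero_mem' := by intro F a _; exact map_zero _
  add_mem' := by
    intro x y hx hy F a h
    have h1 := hx F a h
    have h2 := hy F a h
    rw [map_add, h1, h2, add_zero]
  smul_mem' := by
    intro p
    change ∀ x : cQ k n, (∀ (F : Finset (Fin n)) a, F.card ≠ m → cfQ F a x = 0) → (∀ (F : Finset (Fin n)) a, F.card ≠ m → cfQ F a (p • x) = 0)
    intro x hx F
    induction p using MvPolynomial.induction_on with
    | C c => intro a h; rw [cfQ_C, hx F a h, mul_zero]
    | add p q hp hq => intro a h; rw [add_smul, map_add, hp a h, hq a h, add_zero]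
    | mul_X p i hp =>
      intro a h
      rw [mul_comm, mul_smul, cfQ_X]
      split_ifs
      · exact hp _ h
      · rfl

/-- cycles -/
noncomputable def cZm (m : ℕ) : Submodule (MvPolynomial (Fin n) k) (cQ k n) :=
  cQm k n m ⊓ LinearMap.ker (cD k n)

end Cousin


section Cousin2

variable {k : Type} [Field k] {n : ℕ}

theorem sgn_sq (F : Finset (Fin n)) (v : Fin n) : sgn k F v * sgn k F v = 1 := by
  unfold sgn
  rw [← pow_add, ← two_mul, pow_mul]; simp

theorem sgn_ne (F : Finset (Fin n)) (v : Fin n) : sgn k F v ≠ 0 := by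
  intro h
  have := sgn_sq (k := k) F v
  rw [h] at this; simp at this

theorem sgn_insert {F : Finset (Fin n)} {u : Fin n} (v : Fin n) (hu : u ∉ F) :
    sgn k (insert u F) v = (if u < v then -1 else 1) * sgn k F v := by
  unfold sgn
  rw [Finset.filter_insert]
  split_ifs with h
  · rw [Finset.card_insert_of_notMem (by simp [hu]), pow_succ]; ring
  · ring

theorem sgn_anti {G : Finset (Fin n)} {u v : Fin n} (hu : u ∉ G) (hv : v ∉ G) (huv : u ≠ v) :
    sgn k (insert v G) v * sgn k (insert u (insert v G)) u =
      - (sgn k (insert u G) u * sgn k (insert v (insert u G)) v) := by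
  have h1 : u ∉ insert v G := by simp [hu, huv]
  have h2 : v ∉ insert u G := by simp [hv, huv.symm]
  rw [sgn_insert u h1, sgn_insert v h2, sgn_insert v hv, sgn_insert u hu, sgn_insert u hv, sgn_insert v hu]
  rcases lt_or_gt_of_ne huv with h | h
  · simp [h, not_lt.mpr h.le]; ring
  · simp [h, not_lt.mpr h.le]; ring

theorem cDD (y : cQ k n) : cD k n (cD k n y) = 0 := by
  apply cQ_ext
  intro G a hg
  rw [cfQ_D, if_pos hg, map_zero]
  have : ∀ v ∈ Finset.univ.filter (fun v => v ∉ G), sgn k (insert v G) v * cfQ (insert v G) a (cD k n y) =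
      ∑ u ∈ Finset.univ.filter (fun u => u ∉ insert v G),
        sgn k (insert v G) v * (sgn k (insert u (insert v G)) u * cfQ (insert u (insert v G)) a y) := by
    intro v _
    rw [cfQ_D, if_pos (hg.mono (Finset.subset_insert _ _)), Finset.mul_sum]
  rw [Finset.sum_congr rfl this, Finset.sum_sigma']
  refine Finset.sum_involution (fun p _ => ⟨p.2, p.1⟩) ?_ ?_ ?_ ?_
  · rintro ⟨v, u⟩ h
    simp only [Finset.mem_sigma, Finset.mem_filter, Finset.mem_univ, true_and, Finset.mem_insert, not_or] at h
    have := sgn_anti (k := k) h.2.2 h.1 h.2.1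
    rw [← mul_assoc, ← mul_assoc, this, Finset.insert_comm u v]
    ring
  · rintro ⟨v, u⟩ h _ h'
    simp only [Finset.mem_sigma, Finset.mem_filter, Finset.mem_univ, true_and, Finset.mem_insert, not_or] at h
    simp only [Sigma.mk.injEq] at h'
    exact h.2.1 h'.1
  · rintro ⟨v, u⟩ h
    simp only [Finset.mem_sigma, Finset.mem_filter, Finset.mem_univ, true_and, Finset.mem_insert, not_or] at h ⊢
    exact ⟨h.2.2, fun h' => h.2.1 h'.symm, h.1⟩
  · rintro ⟨v, u⟩ _; rfl

theorem cD_mem {m : ℕ} {y : cQ k n} (hy : y ∈ cQm k n (m+1)) : cD k n y ∈ cZm k n m := by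
  refine ⟨?_, cDD y⟩
  intro F a hF
  rw [cfQ_D]
  split_ifs
  · refine Finset.sum_eq_zero fun v hv => ?_
    simp only [Finset.mem_filter, Finset.mem_univ, true_and] at hv
    rw [hy (insert v F) a, mul_zero]
    rw [Finset.card_insert_of_notMem hv]; omega
  · rfl

theorem cD_surj {m : ℕ} (hm : m < n) {y : cQ k n} (hy : y ∈ cZm k n m) :
    ∃ x ∈ cQm k n (m+1), cD k n x = y := by
  classical
  have hex : ∃ w : (Fin n → ℤ) → Fin n → Prop, (∀ a i j, w a i → w a j → i = j) ∧ (∀ a i, w a i → a i < 0) ∧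
      ∀ a, (∃ i, a i < 0) → ∃ i, w a i := by
    refine ⟨fun a i => ∃ h : ∃ i, a i < 0, i = h.choose, ?_, ?_, ?_⟩
    · rintro a i j ⟨h, rfl⟩ ⟨h', rfl⟩; rfl
    · rintro a i ⟨h, rfl⟩; exact h.choose_spec
    · intro a h; exact ⟨_, h, rfl⟩
  obtain ⟨w, hw1, hw2, hw3⟩ := hex
  obtain ⟨x, hx⟩ := cQ_exists' (k := k)
    (fun F a => ∑ v ∈ F, if w a v then sgn k F v * cfQ (F.erase v) a y else 0) (by
      intro F
      refine (Set.Finite.biUnion (s := (F : Set (Fin n))) (Finset.finite_toSet F)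
        (t := fun v => {a | cfQ (F.erase v) a y ≠ 0}) (fun v _ => cQ_finite y _)).subset ?_
      intro a ha
      obtain ⟨v, hv, hv'⟩ := Finset.exists_ne_zero_of_sum_ne_zero ha
      refine Set.mem_biUnion (Finset.mem_coe.2 hv) ?_
      intro h0
      apply hv'
      rw [h0]; simp)
    (by
      intro F a hF
      refine Finset.sum_eq_zero fun v hv => ?_
      rw [cfQ_bad, mul_zero, ite_self]
      intro h
      exact hF (h.mono (Finset.erase_subset _ _)))
  have hsum : ∀ F a v, w a v → cfQ F a x = if v ∈ F then sgn k F v * cfQ (F.erase v) a y else 0 := by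
    intro F a v hv
    rw [hx]
    split_ifs with h
    · rw [Finset.sum_eq_single v]
      · rw [if_pos hv]
      · intro u _ hu
        rw [if_neg (fun hu' => hu (hw1 _ _ _ hu' hv))]
      · intro h'; exact absurd h h'
    · refine Finset.sum_eq_zero fun u hu => ?_
      rw [if_neg]
      intro hu'
      rw [hw1 _ _ _ hu' hv] at hu
      exact h hu
  refine ⟨x, ?_, ?_⟩
  · intro F a hF
    rw [hx]
    refine Finset.sum_eq_zero fun v hv => ?_
    rw [hy.1 (F.erase v) a, mul_zero, ite_self]
    rw [Finset.card_erase_of_mem hv]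
    have := Finset.card_pos.2 ⟨v, hv⟩
    omega
  · apply cQ_ext
    intro G a hg
    rw [cfQ_D, if_pos hg]
    by_cases hneg : ∃ i, a i < 0
    · obtain ⟨v, hv⟩ := hw3 a hneg
      by_cases hvG : v ∈ G
      · obtain ⟨G', hvG', rfl⟩ : ∃ G', v ∉ G' ∧ G = insert v G' :=
          ⟨G.erase v, Finset.notMem_erase _ _, (Finset.insert_erase hvG).symm⟩
        have hg' : goodDeg G' a := by
          intro i hi
          by_cases hiv : i = v
          · rw [hiv]; exact hw2 _ _ hv
          · exact hg i (by simp [hiv, hi])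
        have hD := congrArg (cfQ G' a) (show cD k n y = 0 from hy.2)
        rw [cfQ_D, if_pos hg', map_zero] at hD
        have hf : Finset.univ.filter (fun u => u ∉ G') = insert v (Finset.univ.filter (fun u => u ∉ insert v G')) := by
          ext u; by_cases h : u = v <;> simp [h, hvG']
        rw [hf, Finset.sum_insert (by simp)] at hD
        have hs : ∑ u ∈ Finset.univ.filter (fun u => u ∉ insert v G'), sgn k (insert u (insert v G')) u * cfQ (insert u (insert v G')) a x
          = ∑ u ∈ Finset.univ.filter (fun u => u ∉ insert v G'), - sgn k (insert v G') v * (sgn k (insert u G') u * cfQ (insert u G') a y) := by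
          refine Finset.sum_congr rfl fun u hu => ?_
          simp only [Finset.mem_filter, Finset.mem_univ, true_and, Finset.mem_insert, not_or] at hu
          rw [hsum _ _ v hv, if_pos (by simp)]
          have h1 : (insert u (insert v G')).erase v = insert u G' := by
            rw [Finset.insert_comm, Finset.erase_insert]; simp [hvG', Ne.symm hu.1]
          have h2 := sgn_anti (k := k) hu.2 hvG' hu.1
          have h3 := sgn_sq (k := k) (insert v G') v
          have h4 := sgn_sq (k := k) (insert v (insert u G')) v
          rw [h1, Finset.insert_comm u v] at *
          generalize sgn k (insert v G') v = A at *
          generalize sgn k (insert v (insert u G')) u = B at *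
          generalize sgn k (insert u G') u = C at *
          generalize sgn k (insert v (insert u G')) v = E at *
          have : B * E = - A * C := by linear_combination (A * E) * h2 - B * E * h3 - C * A * h4
          rw [← mul_assoc, this]; ring
        rw [hs, ← Finset.mul_sum]
        have h3 := sgn_sq (k := k) (insert v G') v
        linear_combination (- sgn k (insert v G') v) * hD + (cfQ (insert v G') a y) * h3
      · rw [Finset.sum_eq_single v]
        · rw [hsum _ _ v hv, if_pos (by simp), Finset.erase_insert hvG, ← mul_assoc, sgn_sq, one_mul]
        · intro u _ hu
          rw [hsum _ _ v hv, if_neg (by simp [hvG, Ne.symm hu]), mul_zero]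
        · intro h; simp [hvG] at h
    · have hG : G = Finset.univ := by
        ext i; simp
        by_contra hi
        exact hneg ⟨i, hg i hi⟩
      rw [hy.1 G a (by rw [hG]; simp; omega)]
      rw [hG]; simp

theorem exists_poly (c : (Fin n →₀ ℕ) → k) (hc : {m | c m ≠ 0}.Finite) :
    ∃ p : MvPolynomial (Fin n) k, ∀ m, p.coeff m = c m := by
  classical
  refine ⟨∑ m ∈ hc.toFinset, MvPolynomial.monomial m (c m), fun m => ?_⟩
  rw [MvPolynomial.coeff_sum]
  simp only [MvPolynomial.coeff_monomial]
  rw [Finset.sum_ite_eq']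
  split_ifs with h
  · rfl
  · simp at h; exact h.symm

/-- exponent to integer vector -/
def expZ (m : Fin n →₀ ℕ) : Fin n → ℤ := fun i => (m i : ℤ)

theorem expZ_inj {m m' : Fin n →₀ ℕ} (h : expZ m = expZ m') : m = m' := by
  ext i
  have := congrFun h i
  simpa [expZ] using this

theorem cf_toLau (p : MvPolynomial (Fin n) k) :
    (∀ m, Lau.cf k n (expZ m) (toLau k n p) = p.coeff m) ∧
    ∀ a : Fin n → ℤ, (∃ i, a i < 0) → Lau.cf k n a (toLau k n p) = 0 := by
  classical
  induction p using MvPolynomial.induction_on with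
  | C c =>
    have h : toLau k n (MvPolynomial.C c) = Lau.mon k n 0 c := by
      rw [toLau, MvPolynomial.eval₂Hom_C]; rfl
    rw [h]
    refine ⟨fun m => ?_, fun a ⟨i, hi⟩ => ?_⟩
    · rw [Lau.cf_mon, MvPolynomial.coeff_C]
      have : expZ m = 0 ↔ 0 = m := by
        constructor
        · intro h; exact (expZ_inj (h.trans (by ext i; simp [expZ]))).symm
        · rintro rfl; ext i; simp [expZ]
      simp [this]
    · rw [Lau.cf_mon, if_neg]
      rintro rfl; simp at hi
  | add p q hp hq =>
    refine ⟨fun m => ?_, fun a h => ?_⟩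
    · rw [map_add, map_add, hp.1, hq.1, MvPolynomial.coeff_add]
    · rw [map_add, map_add, hp.2 a h, hq.2 a h, add_zero]
  | mul_X p i hp =>
    have h : toLau k n (p * MvPolynomial.X i) = Lau.mon k n (Pi.single i 1) 1 * toLau k n p := by
      rw [mul_comm, map_mul]
      congr 1
      rw [toLau, MvPolynomial.eval₂Hom_X']
    rw [h]
    refine ⟨fun m => ?_, fun a ⟨j, hj⟩ => ?_⟩
    · rw [Lau.cf_mon_mul, one_mul, MvPolynomial.coeff_mul_X']
      split_ifs with hm
      · rw [← hp.1]
        congr 2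
        have hm' : m i ≠ 0 := by simpa using hm
        ext j
        by_cases hj : j = i
        · subst hj; simp [expZ]; omega
        · simp [expZ, hj]
      · apply hp.2
        refine ⟨i, ?_⟩
        have hm' : m i = 0 := by simpa using hm
        simp [expZ, hm']
    · rw [Lau.cf_mon_mul, one_mul]
      apply hp.2
      refine ⟨j, ?_⟩
      by_cases hij : j = i
      · subst hij; simp; omega
      · simp [hij]; omega

theorem cZ_top : Nonempty (MvPolynomial (Fin n) k ≃ₗ[MvPolynomial (Fin n) k] cZm k n n) := by
  classical
  let f : MvPolynomial (Fin n) k →ₗ[MvPolynomial (Fin n) k] cQ k n :=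
    (cB k n).mkQ ∘ₗ (LinearMap.single (MvPolynomial (Fin n) k) (fun _ : Finset (Fin n) => Lau k n) Finset.univ) ∘ₗ
      Algebra.linearMap (MvPolynomial (Fin n) k) (Lau k n)
  have hf : ∀ p F a, cfQ F a (f p) = if goodDeg F a then (if F = Finset.univ then Lau.cf k n a (toLau k n p) else 0) else 0 := by
    intro p F a
    have : f p = Submodule.Quotient.mk (Pi.single Finset.univ (toLau k n p)) := rfl
    rw [this, cfQ_mk]
    congr 1
    split_ifs with h
    · subst h; simp
    · rw [Pi.single_eq_of_ne h, map_zero]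
  have hgu : ∀ a : Fin n → ℤ, goodDeg Finset.univ a := fun a i hi => absurd (Finset.mem_univ i) hi
  have hmem : ∀ p, f p ∈ cZm k n n := by
    intro p
    refine ⟨?_, ?_⟩
    · intro F a hF
      rw [hf]
      split_ifs with h1 h2
      · subst h2; simp at hF
      · rfl
      · rfl
    · change cD k n (f p) = 0
      apply cQ_ext
      intro G a hg
      rw [cfQ_D, if_pos hg, map_zero]
      refine Finset.sum_eq_zero fun v hv => ?_
      simp only [Finset.mem_filter, Finset.mem_univ, true_and] at hv
      rw [hf]
      rw [(cf_toLau p).2 a ⟨v, hg v hv⟩]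
      simp
  refine ⟨LinearEquiv.ofBijective (f.codRestrict _ hmem) ⟨?_, ?_⟩⟩
  · rw [injective_iff_map_eq_zero]
    intro p hp
    have hp' : f p = 0 := congrArg Subtype.val hp
    ext m
    have := congrArg (cfQ Finset.univ (expZ m)) hp'
    rw [hf, if_pos (hgu _), if_pos rfl, (cf_toLau p).1, map_zero] at this
    simpa using this
  · rintro ⟨y, hy⟩
    obtain ⟨p, hp⟩ := exists_poly (fun m => cfQ Finset.univ (expZ m) y)
      ((cQ_finite y Finset.univ).preimage (f := expZ) (fun a _ b _ h => expZ_inj h))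
    refine ⟨p, ?_⟩
    apply Subtype.ext
    change f p = y
    apply cQ_ext
    intro F a hg
    rw [hf, if_pos hg]
    split_ifs with h
    · subst h
      by_cases ha : ∃ i, a i < 0
      · rw [(cf_toLau p).2 a ha]
        obtain ⟨i, hi⟩ := ha
        have hD := congrArg (cfQ (Finset.univ.erase i) a) (show cD k n y = 0 from hy.2)
        rw [cfQ_D, if_pos, map_zero, Finset.sum_eq_single i] at hD
        · have := (mul_eq_zero.1 hD).resolve_left (sgn_ne _ _)
          rw [Finset.insert_erase (Finset.mem_univ i)] at this
          exact this.symm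
        · intro b hb hbi; simp at hb; exact absurd hb hbi
        · intro h; simp at h
        · intro j hj; simp at hj; rw [hj]; exact hi
      · push Not at ha
        have : a = expZ (Finsupp.equivFunOnFinite.symm (fun i => (a i).toNat)) := by
          ext i; simp [expZ, ha i]
        rw [this, (cf_toLau p).1, hp]
    · refine (hy.1 F a ?_).symm
      intro hc
      exact h ((Finset.card_eq_iff_eq_univ F).1 (by simpa using hc))

/-- multiplication by an inverse monomial on component F. -/
theorem exists_psi (F : Finset (Fin n)) : ∃ ψ : cQ k n →ₗ[MvPolynomial (Fin n) k] cQ k n,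
    ∀ G a y, cfQ G a (ψ y) = if G = F then cfQ F (a + ∑ i ∈ F, Pi.single i 1) y else 0 := by
  classical
  have hgood : ∀ a, goodDeg F a ↔ goodDeg F (a + ∑ i ∈ F, Pi.single i (1:ℤ)) := by
    intro a
    refine forall_congr' fun i => forall_congr' fun hi => ?_
    have : (∑ j ∈ F, Pi.single j (1:ℤ) : Fin n → ℤ) i = 0 := by
      rw [Finset.sum_apply]
      refine Finset.sum_eq_zero fun j hj => ?_
      rw [Pi.single_eq_of_ne]
      rintro rfl; exact hi hj
    rw [Pi.add_apply, this, add_zero]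
  let ψT : (Finset (Fin n) → Lau k n) →ₗ[MvPolynomial (Fin n) k] (Finset (Fin n) → Lau k n) :=
    LinearMap.single (MvPolynomial (Fin n) k) (fun _ : Finset (Fin n) => Lau k n) F ∘ₗ
      LinearMap.mulLeft (MvPolynomial (Fin n) k) (Lau.mon k n (- ∑ i ∈ F, Pi.single i 1) 1) ∘ₗ
      LinearMap.proj F
  have hψ : ∀ q G a, Lau.cf k n a (ψT q G) = if G = F then Lau.cf k n (a + ∑ i ∈ F, Pi.single i 1) (q F) else 0 := by
    intro q G a
    have : ψT q = Pi.single F (Lau.mon k n (- ∑ i ∈ F, Pi.single i 1) 1 * q F) := rfl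
    rw [this]
    split_ifs with h
    · subst h; rw [Pi.single_eq_same, Lau.cf_mon_mul, one_mul, sub_neg_eq_add]
    · rw [Pi.single_eq_of_ne h, map_zero]
  have hle : cB k n ≤ (cB k n).comap ψT := by
    intro q hq G a hg
    rw [hψ]
    split_ifs with h
    · subst h; exact hq G _ ((hgood a).1 hg)
    · rfl
  refine ⟨Submodule.mapQ _ _ ψT hle, ?_⟩
  · intro G a y
    obtain ⟨q, rfl⟩ := Submodule.Quotient.mk_surjective _ y
    have : (Submodule.mapQ (cB k n) (cB k n) ψT hle) (Submodule.Quotient.mk q) = Submodule.Quotient.mk (ψT q) := rfl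
    rw [this, cfQ_mk, hψ, cfQ_mk]
    by_cases h2 : G = F
    · subst h2
      by_cases h1 : goodDeg G a
      · rw [if_pos h1, if_pos rfl, if_pos rfl, if_pos ((hgood a).1 h1)]
      · rw [if_neg h1, if_pos rfl, if_neg (fun h => h1 ((hgood a).2 h))]
    · rw [if_neg h2, if_neg h2, ite_self]

theorem cfQ_xF (s F : Finset (Fin n)) (a : Fin n → ℤ) (y : cQ k n) (hg : goodDeg F a) :
    cfQ F a ((∏ i ∈ s, MvPolynomial.X (R := k) i) • y) = cfQ F (a - ∑ i ∈ s, Pi.single i 1) y := by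
  classical
  induction s using Finset.induction_on generalizing a with
  | empty => simp
  | insert i s hi ih =>
    rw [Finset.prod_insert hi, mul_smul, cfQ_X, if_pos hg, ih _ (hg.sub i), Finset.sum_insert hi, sub_sub]

theorem ext_SR (Δ : SC n) (d : ℕ) (hdn : d ≤ n) (hd : ∀ F ∈ Δ.faces, F.card ≤ d) :
    Nonempty (extMod (MvPolynomial (Fin n) k) (SRRing k Δ) (MvPolynomial (Fin n) k) (n - d)
      ≃ₗ[MvPolynomial (Fin n) k] (SRRing k Δ →ₗ[MvPolynomial (Fin n) k] cZm k n d)) := by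
  classical
  obtain ⟨e⟩ := cZ_top (k := k) (n := n)
  refine extMod_chain (SRRing k Δ) (MvPolynomial (Fin n) k) (fun j => cZm k n j) (fun j => cQm k n j) n d hdn e
    (fun j => Submodule.inclusion inf_le_left)
    (fun j => LinearMap.codRestrict _ (cD k n ∘ₗ (cQm k n (j+1)).subtype) (fun y => cD_mem y.2)) ?_ ?_ ?_ ?_
  · intro j; exact Submodule.inclusion_injective _
  · rintro j hj ⟨y, hy⟩
    obtain ⟨x, hx, hxy⟩ := cD_surj hj hy
    exact ⟨⟨x, hx⟩, Subtype.ext hxy⟩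
  · rintro j ⟨y, hy⟩
    constructor
    · intro h
      exact ⟨⟨y, hy, congrArg Subtype.val h⟩, rfl⟩
    · rintro ⟨⟨z, hz⟩, h⟩
      obtain rfl : z = y := congrArg Subtype.val h
      exact Subtype.ext hz.2
  · intro j hj
    choose ψ hψ using fun F : Finset (Fin n) => exists_psi (k := k) F
    have hmem : ∀ F y, y ∈ cQm k n j → ψ F y ∈ cQm k n j := by
      intro F y hy G a hG
      rw [hψ]
      split_ifs with h
      · subst h; exact hy _ _ hG
      · rfl
    refine ⟨Finset (Fin n), Finset.univ.filter (fun F => F.card = j),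
      fun F => if F.card = j then ∏ i ∈ F, MvPolynomial.X i else 0,
      fun F => (ψ F).restrict (hmem F), ?_, ?_⟩
    · intro F x
      beta_reduce; split_ifs with h
      · obtain ⟨p, rfl⟩ := Ideal.Quotient.mk_surjective x
        have h1 : (∏ i ∈ F, MvPolynomial.X (R := k) i) ∈ srIdeal k Δ := by
          apply Ideal.subset_span
          refine ⟨F, ?_, rfl⟩
          intro hF
          have := hd F hF
          omega
        exact (Ideal.Quotient.eq_zero_iff_mem (a := (∏ i ∈ F, MvPolynomial.X (R := k) i) * p)).2 (Ideal.mul_mem_right _ _ h1)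
      · exact zero_smul _ _
    · rintro ⟨y, hy⟩
      apply Subtype.ext
      rw [AddSubmonoidClass.coe_finsetSum]
      apply cQ_ext
      intro G a hg
      have : ∀ F ∈ Finset.univ.filter (fun F : Finset (Fin n) => F.card = j),
          cfQ G a ((((if F.card = j then ∏ i ∈ F, MvPolynomial.X (R := k) i else 0) • (ψ F).restrict (hmem F) ⟨y, hy⟩ : cQm k n j) : cQ k n))
          = if G = F then cfQ G a y else 0 := by
        intro F hF
        have hF' : F.card = j := by simpa using hF
        rw [if_pos hF', Submodule.coe_smul, cfQ_xF _ _ _ _ hg]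
        rw [LinearMap.coe_restrict_apply, hψ]
        split_ifs with h
        · subst h; rw [sub_add_cancel]
        · rfl
      rw [map_sum, Finset.sum_congr rfl this, Finset.sum_ite_eq]
      split_ifs with h
      · rfl
      · exact (hy G a (by simpa using h)).symm

end Cousin2


section Krull

variable {k : Type} [Field k] {n : ℕ}

/-- restriction to a face -/
noncomputable def faceHom (k : Type) [Field k] (F : Finset (Fin n)) :
    MvPolynomial (Fin n) k →ₐ[k] MvPolynomial F k :=
  MvPolynomial.aeval (fun i => if h : i ∈ F then MvPolynomial.X ⟨i, h⟩ else 0)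

theorem faceHom_surj (F : Finset (Fin n)) : Function.Surjective (faceHom k F) := by
  have : (faceHom k F).comp (MvPolynomial.rename (Subtype.val : F → Fin n)) = AlgHom.id k _ := by
    apply MvPolynomial.algHom_ext
    intro i
    simp [faceHom]
  intro p
  exact ⟨MvPolynomial.rename Subtype.val p, DFunLike.congr_fun this p⟩

theorem faceHom_dim (F : Finset (Fin n)) : ringKrullDim (MvPolynomial F k) = (F.card : WithBot ℕ∞) := by
  have := MvPolynomial.ringKrullDim_of_isNoetherianRing (R := k) (ι := F)
  rw [this]
  simp

theorem krull_upper (Δ : SC n) (d : ℕ) (hd : ∀ F ∈ Δ.faces, F.card ≤ d) :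
    ringKrullDim (SRRing k Δ) ≤ (d : WithBot ℕ∞) := by
  classical
  rw [ringKrullDim_quotient]
  refine iSup_le fun l => ?_
  let p0 : Ideal (MvPolynomial (Fin n) k) := l.head.1.asIdeal
  have hI : srIdeal k Δ ≤ p0 := l.head.2
  have : p0.IsPrime := l.head.1.2
  let F : Finset (Fin n) := Finset.univ.filter (fun i => MvPolynomial.X i ∉ p0)
  have hF : F ∈ Δ.faces := by
    by_contra h
    have h1 : (∏ i ∈ F, MvPolynomial.X (R := k) i) ∈ p0 := hI (Ideal.subset_span ⟨F, h, rfl⟩)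
    rw [Ideal.IsPrime.prod_mem_iff] at h1
    obtain ⟨i, hi, hi'⟩ := h1
    simp [F] at hi
    exact hi hi'
  let P : Ideal (MvPolynomial (Fin n) k) := RingHom.ker (faceHom k F).toRingHom
  have hP : P ≤ p0 := by
    intro p hp
    have h2 : (((Ideal.Quotient.mkₐ k p0).comp (MvPolynomial.rename (Subtype.val : F → Fin n))).comp (faceHom k F)) = Ideal.Quotient.mkₐ k p0 := by
      apply MvPolynomial.algHom_ext
      intro i
      by_cases h : i ∈ F
      · simp [faceHom, h]
      · have hi : MvPolynomial.X i ∈ p0 := by simpa [F] using h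
        simp [faceHom, h]
        exact (Ideal.Quotient.eq_zero_iff_mem.2 hi).symm
    have h3 := DFunLike.congr_fun h2 p
    have h4 : faceHom k F p = 0 := hp
    rw [← Ideal.Quotient.eq_zero_iff_mem]
    change Ideal.Quotient.mkₐ k p0 p = 0
    rw [← h3]
    change Ideal.Quotient.mkₐ k p0 (MvPolynomial.rename _ (faceHom k F p)) = 0
    rw [h4]; simp
  have hdim : ringKrullDim (MvPolynomial (Fin n) k ⧸ P) = (F.card : WithBot ℕ∞) := by
    rw [← faceHom_dim (k := k) F]
    exact ringKrullDim_eq_of_ringEquiv (RingHom.quotientKerEquivOfSurjective (f := (faceHom k F).toRingHom) (faceHom_surj F))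
  rw [ringKrullDim_quotient] at hdim
  let l' : LTSeries (PrimeSpectrum.zeroLocus (P : Set (MvPolynomial (Fin n) k))) :=
    { length := l.length
      toFun := fun i => ⟨(l i).1, fun p hp => (show l.head.1 ≤ (l i).1 from LTSeries.head_le l i) (hP hp)⟩
      step := fun i => l.step i }
  calc ((l.length : ℕ) : WithBot ℕ∞) = l'.length := rfl
    _ ≤ Order.krullDim (PrimeSpectrum.zeroLocus (P : Set (MvPolynomial (Fin n) k))) := le_iSup (fun l : LTSeries (PrimeSpectrum.zeroLocus (P : Set (MvPolynomial (Fin n) k))) => (l.length : WithBot ℕ∞)) l'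
    _ = F.card := hdim
    _ ≤ d := by exact_mod_cast hd F hF

theorem krull_lower (Δ : SC n) (F : Finset (Fin n)) (hF : F ∈ Δ.faces) :
    (F.card : WithBot ℕ∞) ≤ ringKrullDim (SRRing k Δ) := by
  rw [← faceHom_dim (k := k) F]
  refine ringKrullDim_le_of_surjective (Ideal.Quotient.lift (srIdeal k Δ) (faceHom k F).toRingHom ?_) ?_
  · have : srIdeal k Δ ≤ RingHom.ker (faceHom k F).toRingHom := by
      refine Ideal.span_le.2 ?_
      rintro _ ⟨σ, hσ, rfl⟩
      change faceHom k F (∏ i ∈ σ, MvPolynomial.X i) = 0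
      obtain ⟨i, hi, hiF⟩ : ∃ i ∈ σ, i ∉ F := by
        by_contra h
        push Not at h
        exact hσ (Δ.down_closed hF h)
      rw [map_prod]
      apply Finset.prod_eq_zero hi
      simp [faceHom, hiF]
    exact fun a ha => this ha
  · exact Ideal.Quotient.lift_surjective_of_surjective _ _ (faceHom_surj F)

theorem krull_SR (Δ : SC n) : ringKrullDim (SRRing k Δ) = ((Δ.faces.sup Finset.card : ℕ) : WithBot ℕ∞) := by
  apply le_antisymm
  · exact krull_upper Δ _ (fun F hF => Finset.le_sup (f := Finset.card) hF)
  · obtain ⟨F, hF, h⟩ := Finset.exists_mem_eq_sup Δ.faces ⟨∅, Δ.empty_mem⟩ Finset.card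
    rw [h]
    exact krull_lower Δ F hF

end Krull


section Comb

variable {k : Type} [Field k] {n : ℕ}

/-- boundary of a function on finsets -/
def bdr (z : Finset (Fin n) → k) (G : Finset (Fin n)) : k :=
  ∑ v ∈ Finset.univ.filter (fun v => v ∉ G), sgn k (insert v G) v * z (insert v G)

theorem bdr_smul (c : k) (z : Finset (Fin n) → k) (G : Finset (Fin n)) :
    bdr (fun F => c * z F) G = c * bdr z G := by
  unfold bdr
  rw [Finset.mul_sum]
  exact Finset.sum_congr rfl fun v _ => by ring

theorem relBoundary_eq (Γ : SC n) (i : ℕ) (z : Finset (Fin n) → k)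
    (hz : ∀ F, z F ≠ 0 → F ∈ Γ.faces ∧ F.card = i + 1) (ρ : Γ.RFace ∅ i) :
    Γ.relBoundary k ∅ i (fun F => z F.1) ρ = bdr z ρ.1 := by
  classical
  have h1 : Γ.relBoundary k ∅ i (fun F => z F.1) ρ =
      ∑ T : {τ : Finset (Fin n) // τ ∈ Γ.faces ∧ ∅ ⊆ τ ∧ τ.card = i + 1},
        (∑ v ∈ T.1, if v ∉ (∅ : Finset (Fin n)) ∧ T.1.erase v = ρ.1
          then (-1 : k) ^ ((T.1.filter (fun w => w < v)).card) else 0) * z T.1 := rfl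
  rw [h1]
  rw [← Finset.sum_subtype (Finset.univ.filter (fun T : Finset (Fin n) => T ∈ Γ.faces ∧ ∅ ⊆ T ∧ T.card = i + 1))
    (by simp) (fun T => (∑ v ∈ T, if v ∉ (∅ : Finset (Fin n)) ∧ T.erase v = ρ.1
          then (-1 : k) ^ ((T.filter (fun w => w < v)).card) else 0) * z T)]
  rw [Finset.sum_filter_of_ne (p := fun T : Finset (Fin n) => T ∈ Γ.faces ∧ ∅ ⊆ T ∧ T.card = i + 1)]
  swap
  · intro T _ hT
    have := hz T (fun h0 => hT (by rw [h0, mul_zero]))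
    exact ⟨this.1, Finset.empty_subset _, this.2⟩
  have h2 : ∀ T : Finset (Fin n), (∑ v ∈ T, if v ∉ (∅ : Finset (Fin n)) ∧ T.erase v = ρ.1
          then (-1 : k) ^ ((T.filter (fun w => w < v)).card) else 0) * z T =
      ∑ v, if T = insert v ρ.1 then (if v ∉ ρ.1 then sgn k (insert v ρ.1) v * z (insert v ρ.1) else 0) else 0 := by
    intro T
    rw [Finset.sum_mul, ← Finset.sum_subset (Finset.subset_univ T)]
    · refine Finset.sum_congr rfl fun v hv => ?_
      by_cases h : T.erase v = ρ.1
      · have hT : T = insert v ρ.1 := by rw [← h, Finset.insert_erase hv]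
        have hv' : v ∉ ρ.1 := by rw [← h]; exact Finset.notMem_erase _ _
        rw [if_pos ⟨by simp, h⟩, if_pos hT, if_pos hv', ← hT]; rfl
      · rw [if_neg (fun h' => h h'.2), zero_mul]
        split_ifs with h3 h4
        · rfl
        · exact absurd (by rw [h3, Finset.erase_insert h4]) h
        · rfl
    · intro v _ hv
      rw [if_neg]
      rintro rfl
      simp at hv
  rw [Finset.sum_congr rfl (fun T _ => h2 T), Finset.sum_comm, bdr, Finset.sum_filter]
  refine Finset.sum_congr rfl fun v _ => ?_
  rw [Finset.sum_ite_eq']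
  simp

/-- extension by zero of a chain -/
noncomputable def extz (Γ : SC n) (i : ℕ) (x : Γ.relChain k ∅ i) (F : Finset (Fin n)) : k := by
  classical
  exact if h : F ∈ Γ.faces ∧ ∅ ⊆ F ∧ F.card = i then x ⟨F, h⟩ else 0

theorem extz_supp (Γ : SC n) (i : ℕ) (x : Γ.relChain k ∅ i) (F : Finset (Fin n)) (h : extz Γ i x F ≠ 0) :
    F ∈ Γ.faces ∧ F.card = i := by
  unfold extz at h
  split_ifs at h with h'
  · exact ⟨h'.1, h'.2.2⟩
  · exact absurd rfl h

theorem extz_restr (Γ : SC n) (i : ℕ) (x : Γ.relChain k ∅ i) : (fun F : Γ.RFace ∅ i => extz Γ i x F.1) = x := by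
  funext F
  unfold extz
  rw [dif_pos F.2]; rfl

theorem top_hom (Γ : SC n) (e : ℕ) (hd : ∀ F ∈ Γ.faces, F.card ≤ e + 1)
    (H : Nonempty (Γ.reducedHomology k e ≃ₗ[k] k)) :
    ∃ o : Finset (Fin n) → k, (∀ F, o F ≠ 0 → F ∈ Γ.faces ∧ F.card = e + 1) ∧ (∀ G, bdr o G = 0) ∧
      (∃ F, o F ≠ 0) ∧ ∀ z : Finset (Fin n) → k, (∀ F, z F ≠ 0 → F ∈ Γ.faces ∧ F.card = e + 1) →
        (∀ G, bdr z G = 0) → ∃ c : k, ∀ F, z F = c * o F := by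
  classical
  obtain ⟨q⟩ := H
  have hemp : ∀ x : Γ.relChain k ∅ (e + 1 + 1), x = 0 := by
    intro x; funext F
    have := hd F.1 F.2.1
    have h2 := F.2.2.2
    omega
  let K := LinearMap.ker (Γ.relBoundary k ∅ e)
  let B := Submodule.comap K.subtype (LinearMap.range (Γ.relBoundary k ∅ (e+1)))
  have hB : ∀ x ∈ B, x = 0 := by
    rintro x ⟨y, hy⟩
    rw [hemp y, map_zero] at hy
    exact Subtype.ext hy.symm
  let q' : (K ⧸ B) ≃ₗ[k] k := q
  obtain ⟨o1, ho1⟩ := Submodule.Quotient.mk_surjective _ (q'.symm 1)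
  have hcyc : ∀ x : Γ.relChain k ∅ (e+1), x ∈ K → ∀ G, bdr (extz Γ (e+1) x) G = 0 := by
    intro x hx G
    by_cases hG : G ∈ Γ.faces ∧ G.card = e
    · have := relBoundary_eq Γ e (extz Γ (e+1) x) (extz_supp Γ _ x) ⟨G, hG.1, Finset.empty_subset _, hG.2⟩
      rw [extz_restr] at this
      rw [← this]
      exact congrFun hx _
    · refine Finset.sum_eq_zero fun v hv => ?_
      by_contra hne
      have h1 := extz_supp Γ _ x _ (right_ne_zero_of_mul hne)
      apply hG
      simp only [Finset.mem_filter, Finset.mem_univ, true_and] at hv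
      refine ⟨Γ.down_closed h1.1 (Finset.subset_insert _ _), ?_⟩
      have := h1.2
      rw [Finset.card_insert_of_notMem hv] at this
      omega
  refine ⟨extz Γ (e+1) o1.1, extz_supp Γ _ _, hcyc _ o1.2, ?_, ?_⟩
  · by_contra h
    push Not at h
    have h1 : o1 = 0 := by
      apply Subtype.ext
      rw [← extz_restr Γ _ o1.1]
      funext F
      exact h _
    rw [h1] at ho1
    have : q'.symm 1 = 0 := ho1.symm
    rw [LinearEquiv.map_eq_zero_iff] at this
    exact one_ne_zero this
  · intro z hz hz'
    have hzK : (fun F : Γ.RFace ∅ (e+1) => z F.1) ∈ K := by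
      change Γ.relBoundary k ∅ e _ = 0
      funext ρ
      rw [relBoundary_eq Γ e z hz ρ, hz']; rfl
    let z1 : K := ⟨_, hzK⟩
    let c := q' (Submodule.Quotient.mk z1)
    have h1 : (Submodule.Quotient.mk z1 : K ⧸ B) = Submodule.Quotient.mk (c • o1) := by
      rw [Submodule.Quotient.mk_smul]
      apply q'.injective
      rw [map_smul, ho1, LinearEquiv.apply_symm_apply]
      simp [c]
    have h2 := hB _ ((Submodule.Quotient.eq B).1 h1)
    have h3 : z1 = c • o1 := sub_eq_zero.1 h2
    refine ⟨c, fun F => ?_⟩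
    by_cases hF : F ∈ Γ.faces ∧ F.card = e + 1
    · have h4 := congrFun (congrArg Subtype.val h3) (⟨F, hF.1, Finset.empty_subset _, hF.2⟩ : Γ.RFace ∅ (e+1))
      change z F = c * o1.1 _ at h4
      rw [h4]
      congr 1
      unfold extz
      rw [dif_pos ⟨hF.1, Finset.empty_subset _, hF.2⟩]
    · have h5 : z F = 0 := by by_contra h; exact hF (hz F h)
      have h6 : extz Γ (e+1) o1.1 F = 0 := by by_contra h; exact hF (extz_supp Γ _ _ F h)
      rw [h5, h6, mul_zero]

theorem conn_of_H0 (Γ : SC n) (H : Subsingleton (Γ.reducedHomology k 0)) (u v : Fin n)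
    (hu : {u} ∈ Γ.faces) (hv : {v} ∈ Γ.faces) :
    Relation.ReflTransGen (fun a b => ({a, b} : Finset (Fin n)) ∈ Γ.faces) u v := by
  classical
  by_contra hcon
  have huv : u ≠ v := by rintro rfl; exact hcon Relation.ReflTransGen.refl
  let z : Finset (Fin n) → k := fun F => if F = {u} then 1 else if F = {v} then -1 else 0
  have hz : ∀ F, z F ≠ 0 → F ∈ Γ.faces ∧ F.card = 0 + 1 := by
    intro F hF
    simp only [z] at hF
    split_ifs at hF with h1 h2
    · subst h1; exact ⟨hu, by simp⟩
    · subst h2; exact ⟨hv, by simp⟩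
    · exact absurd rfl hF
  have hzK : (fun F : Γ.RFace ∅ (0+1) => z F.1) ∈ LinearMap.ker (Γ.relBoundary k ∅ 0) := by
    change Γ.relBoundary k ∅ 0 _ = 0
    funext ρ
    rw [relBoundary_eq Γ 0 z hz ρ]
    have : ρ.1 = ∅ := Finset.card_eq_zero.1 ρ.2.2.2
    rw [this]
    change ∑ w ∈ _, _ = (0:k)
    have hs : ∀ w : Fin n, sgn k (insert w ∅) w = 1 := by
      intro w; simp [sgn, Finset.filter_singleton]
    simp only [hs, one_mul, Finset.notMem_empty, not_false_eq_true, Finset.filter_true, z]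
    have : ∀ w : Fin n, (if insert w (∅ : Finset (Fin n)) = {u} then (1:k) else if insert w (∅ : Finset (Fin n)) = {v} then -1 else 0)
      = (if w = u then 1 else 0) - (if w = v then 1 else 0) := by
      intro w
      have e1 : ∀ t : Fin n, (insert w (∅ : Finset (Fin n)) = {t}) ↔ w = t := by intro t; simp
      simp only [e1]
      by_cases h1 : w = u
      · subst h1; simp [huv]
      · simp [h1]; split_ifs <;> simp
    rw [Finset.sum_congr rfl (fun w _ => this w), Finset.sum_sub_distrib]
    simp
  have hq : (Submodule.Quotient.mk (⟨_, hzK⟩ : LinearMap.ker (Γ.relBoundary k ∅ 0)) : Γ.reducedHomology k 0) =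
     (Submodule.Quotient.mk 0 : _) := @Subsingleton.elim _ H _ _
  have hmem := (Submodule.Quotient.eq _).1 hq
  obtain ⟨x, hx⟩ := hmem
  rw [sub_zero] at hx
  have hx' : ∀ ρ : Γ.RFace ∅ 1, bdr (extz Γ 2 x) ρ.1 = z ρ.1 := by
    intro ρ
    rw [← relBoundary_eq Γ 1 _ (extz_supp Γ 2 x), extz_restr, hx]; rfl
  let χ : Fin n → k := fun w => if Relation.ReflTransGen (fun a b => ({a, b} : Finset (Fin n)) ∈ Γ.faces) u w then 1 else 0
  have hχ : ∀ w t, extz Γ 2 x {w, t} ≠ 0 → χ w = χ t := by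
    intro w t h
    have h1 := (extz_supp Γ 2 x _ h).1
    simp only [χ]
    congr 1
    apply propext
    constructor
    · intro h2; exact h2.tail h1
    · intro h2; exact h2.tail (by rwa [Finset.pair_comm])
  have hall : ∀ w, bdr (extz Γ 2 x) {w} = z {w} := by
    intro w
    by_cases hw : {w} ∈ Γ.faces
    · exact hx' ⟨{w}, hw, Finset.empty_subset _, by simp⟩
    · have h1 : z {w} = 0 := by by_contra h; exact hw (hz _ h).1
      rw [h1]
      refine Finset.sum_eq_zero fun t _ => ?_
      by_contra h
      exact hw (Γ.down_closed (extz_supp Γ 2 x _ (right_ne_zero_of_mul h)).1 (Finset.subset_insert _ _))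
  have hL : ∑ w, χ w * bdr (extz Γ 2 x) {w} = 0 := by
    have : ∀ w ∈ Finset.univ, χ w * bdr (extz Γ 2 x) {w} = ∑ t ∈ Finset.univ.filter (fun t => t ∉ ({w} : Finset (Fin n))),
        χ w * (sgn k (insert t {w}) t * extz Γ 2 x (insert t {w})) := by
      intro w _
      rw [bdr, Finset.mul_sum]
    rw [Finset.sum_congr rfl this, Finset.sum_sigma']
    refine Finset.sum_involution (fun p _ => ⟨p.2, p.1⟩) ?_ ?_ ?_ ?_
    · rintro ⟨w, t⟩ h
      simp only [Finset.mem_sigma, Finset.mem_filter, Finset.mem_univ, true_and, Finset.mem_singleton] at h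
      have e1 : (insert w {t} : Finset (Fin n)) = insert t {w} := Finset.pair_comm w t
      simp only [e1]
      by_cases h0 : extz Γ 2 x (insert t {w}) = 0
      · rw [h0]; simp
      · rw [hχ t w h0]
        have h2 := sgn_anti (k := k) (G := ∅) (u := w) (v := t) (by simp) (by simp) (Ne.symm h)
        have hs : ∀ w : Fin n, sgn k (insert w ∅) w = 1 := by
          intro w; simp [sgn, Finset.filter_singleton]
        rw [hs, hs, one_mul, one_mul] at h2
        have h3 : sgn k (insert w {t}) w = - sgn k (insert t {w}) t := h2
        rw [e1] at h3
        rw [h3]; ring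
    · rintro ⟨w, t⟩ h _ h'
      simp only [Finset.mem_sigma, Finset.mem_filter, Finset.mem_univ, true_and, Finset.mem_singleton] at h
      simp only [Sigma.mk.injEq] at h'
      exact h h'.1
    · rintro ⟨w, t⟩ h
      simp only [Finset.mem_sigma, Finset.mem_filter, Finset.mem_univ, true_and, Finset.mem_singleton] at h ⊢
      exact Ne.symm h
    · rintro ⟨w, t⟩ _; rfl
  have hL2 : ∑ w, χ w * bdr (extz Γ 2 x) {w} = 1 := by
    rw [Finset.sum_eq_single u]
    · rw [hall]
      simp only [χ, z, if_pos, Relation.ReflTransGen.refl]; simp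
    · intro w _ hw
      rw [hall]
      by_cases hwv : w = v
      · subst hwv
        simp only [χ]
        rw [if_neg hcon, zero_mul]
      · simp [z, hw, hwv]
    · intro h; simp at h
  rw [hL] at hL2
  exact zero_ne_one hL2

end Comb


section Comb2

variable {k : Type} [Field k] {n : ℕ}

theorem mem_link {Δ : SC n} {τ : Finset (Fin n)} (hτ : τ ∈ Δ.faces) (σ : Finset (Fin n)) :
    σ ∈ (Δ.link τ hτ).faces ↔ Disjoint σ τ ∧ σ ∪ τ ∈ Δ.faces := by
  simp only [SC.link, Finset.mem_filter, Finset.disjoint_iff_inter_eq_empty]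
  constructor
  · rintro ⟨_, h1, h2⟩; exact ⟨h1, h2⟩
  · rintro ⟨h1, h2⟩; exact ⟨Δ.down_closed h2 Finset.subset_union_left, h1, h2⟩

theorem link_conn {Δ : SC n} (hM : Δ.IsHomologyManifold k) {τ : Finset (Fin n)} (hτ : τ ∈ Δ.faces)
    (hbig : ∃ F ∈ Δ.faces, τ ⊆ F ∧ τ.card + 2 ≤ F.card) {u v : Fin n} (hu : u ∉ τ) (hv : v ∉ τ)
    (hu' : insert u τ ∈ Δ.faces) (hv' : insert v τ ∈ Δ.faces) :
    Relation.ReflTransGen (fun a b => a ∉ τ ∧ b ∉ τ ∧ insert a (insert b τ) ∈ Δ.faces) u v := by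
  classical
  by_cases h0 : τ = ∅
  · subst h0
    refine Relation.ReflTransGen.mono ?_ _ _ (hM.1.2 u v hu' hv')
    intro a b hab
    exact ⟨by simp, by simp, hab⟩
  · have hs := hM.2 τ hτ h0
    obtain ⟨F, hF, hτF, hc⟩ := hbig
    have hFl : F \ τ ∈ (Δ.link τ hτ).faces := by
      rw [mem_link]
      exact ⟨Finset.sdiff_disjoint, by rwa [Finset.sdiff_union_of_subset hτF]⟩
    have hc2 : 2 ≤ (F \ τ).card := by rw [Finset.card_sdiff_of_subset hτF]; omega
    have hdim : ((0:ℕ) : ℤ) ≠ (Δ.link τ hτ).dim := by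
      have := Finset.le_sup (f := Finset.card) hFl
      unfold SC.dim
      omega
    have hvert : ∀ w, w ∉ τ → insert w τ ∈ Δ.faces → {w} ∈ (Δ.link τ hτ).faces := by
      intro w hw hw'
      rw [mem_link]
      exact ⟨by simpa using hw, hw'⟩
    refine Relation.ReflTransGen.mono ?_ _ _ (conn_of_H0 (Δ.link τ hτ) ((hs.1 0).2 hdim) u v (hvert u hu hu') (hvert v hv hv'))
    intro a b hab
    rw [mem_link] at hab
    simp only [Finset.disjoint_insert_left, Finset.disjoint_singleton_left] at hab
    refine ⟨hab.1.1, hab.1.2, ?_⟩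
    have := hab.2
    rwa [Finset.insert_union] at this

theorem exists_facet {Δ : SC n} {τ : Finset (Fin n)} (hτ : τ ∈ Δ.faces) : ∃ F, Δ.IsFacet F ∧ τ ⊆ F := by
  classical
  obtain ⟨F, hF, hmax⟩ := Finset.exists_max_image (Δ.faces.filter (fun F => τ ⊆ F)) Finset.card
    ⟨τ, by simp [hτ]⟩
  simp only [Finset.mem_filter] at hF hmax
  refine ⟨F, ⟨hF.1, fun G hG hFG => ?_⟩, hF.2⟩
  exact Finset.eq_of_subset_of_card_le hFG (hmax G ⟨hG, hF.2.trans hFG⟩)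

theorem purity_aux {Δ : SC n} (hM : Δ.IsHomologyManifold k) (m : ℕ) : ∀ τ ∈ Δ.faces, n - τ.card ≤ m →
    ∀ F F', Δ.IsFacet F → Δ.IsFacet F' → τ ⊆ F → τ ⊆ F' → F.card = F'.card := by
  classical
  have hcn : ∀ F : Finset (Fin n), F.card ≤ n := fun F => by simpa using Finset.card_le_univ F
  induction m with
  | zero =>
    intro τ hτ hc F F' hF hF' h1 h2
    have := Finset.card_le_card h1
    have := Finset.card_le_card h2
    have := hcn F
    have := hcn F'
    omega
  | succ m ih =>
    intro τ hτ hc F F' hF hF' h1 h2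
    by_cases e1 : F = τ
    · subst e1; rw [hF.2 F' hF'.1 h2]
    by_cases e2 : F' = τ
    · subst e2; rw [hF'.2 F hF.1 h1]
    have hex : ∀ G, τ ⊆ G → G ≠ τ → ∃ u ∈ G, u ∉ τ := by
      intro G h1 h2
      by_contra h
      push Not at h
      exact h2 (Finset.Subset.antisymm h h1)
    have hlt : ∀ G u, τ ⊆ G → u ∈ G → u ∉ τ → τ.card + 1 ≤ G.card := by
      intro G u h1 h2 h3
      rw [← Finset.card_insert_of_notMem h3]
      exact Finset.card_le_card (Finset.insert_subset h2 h1)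
    obtain ⟨u, hu, huτ⟩ := hex F h1 e1
    obtain ⟨v, hv, hvτ⟩ := hex F' h2 e2
    by_cases hbig : ∃ G ∈ Δ.faces, τ ⊆ G ∧ τ.card + 2 ≤ G.card
    · have hpath := link_conn hM hτ hbig huτ hvτ (Δ.down_closed hF.1 (Finset.insert_subset hu h1))
        (Δ.down_closed hF'.1 (Finset.insert_subset hv h2))
      have step : ∀ w, Relation.ReflTransGen (fun a b => a ∉ τ ∧ b ∉ τ ∧ insert a (insert b τ) ∈ Δ.faces) u w →
          w ∉ τ ∧ ∃ G, Δ.IsFacet G ∧ insert w τ ⊆ G ∧ G.card = F.card := by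
        intro w hw
        induction hw with
        | refl => exact ⟨huτ, F, hF, Finset.insert_subset hu h1, rfl⟩
        | @tail a b _ hab ihp =>
          refine ⟨hab.2.1, ?_⟩
          obtain ⟨_, G, hG, hG1, hG2⟩ := ihp
          obtain ⟨G', hG', hG'1⟩ := exists_facet hab.2.2
          refine ⟨G', hG', (Finset.subset_insert _ _).trans hG'1, ?_⟩
          rw [← hG2]
          refine ih (insert a τ) (Δ.down_closed hG.1 hG1) ?_ G' G hG' hG ?_ hG1
          · rw [Finset.card_insert_of_notMem hab.1]; omega
          · refine Finset.Subset.trans ?_ hG'1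
            exact Finset.insert_subset_insert _ (Finset.subset_insert _ _)
      obtain ⟨_, G, hG, hG1, hG2⟩ := step v hpath
      rw [← hG2]
      refine ih (insert v τ) (Δ.down_closed hG.1 hG1) ?_ G F' hG hF' hG1 (Finset.insert_subset hv h2)
      rw [Finset.card_insert_of_notMem hvτ]; omega
    · push Not at hbig
      have a1 := hbig F hF.1 h1
      have a2 := hbig F' hF'.1 h2
      have a3 := hlt F u h1 hu huτ
      have a4 := hlt F' v h2 hv hvτ
      omega

theorem purity {Δ : SC n} (hM : Δ.IsHomologyManifold k) {τ : Finset (Fin n)} (hτ : τ ∈ Δ.faces) :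
    ∃ F ∈ Δ.faces, τ ⊆ F ∧ F.card = Δ.faces.sup Finset.card := by
  obtain ⟨F0, hF0, h0⟩ := Finset.exists_mem_eq_sup Δ.faces ⟨∅, Δ.empty_mem⟩ Finset.card
  have hfac : Δ.IsFacet F0 := by
    refine ⟨hF0, fun G hG h => Finset.eq_of_subset_of_card_le h ?_⟩
    rw [← h0]; exact Finset.le_sup (f := Finset.card) hG
  obtain ⟨F, hF, hF'⟩ := exists_facet hτ
  refine ⟨F, hF.1, hF', ?_⟩
  rw [h0]
  exact purity_aux hM n ∅ Δ.empty_mem (by simp) F F0 hF hfac (by simp) (by simp)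

/-- relative top cycles -/
def isZ (Δ : SC n) (d : ℕ) (τ : Finset (Fin n)) (z : Finset (Fin n) → k) : Prop :=
  (∀ F, z F ≠ 0 → F ∈ Δ.faces ∧ F.card = d ∧ τ ⊆ F) ∧ ∀ G, τ ⊆ G → bdr z G = 0

/-- sign twist -/
noncomputable def epsS (k : Type) [Field k] (τ F : Finset (Fin n)) : k := ∏ i ∈ F, sgn k τ i

theorem epsS_sq (τ F : Finset (Fin n)) : epsS k τ F * epsS k τ F = 1 := by
  unfold epsS
  rw [← Finset.prod_mul_distrib]
  exact Finset.prod_eq_one fun i _ => sgn_sq _ _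

theorem epsS_ne (τ F : Finset (Fin n)) : epsS k τ F ≠ 0 := by
  intro h
  have := epsS_sq (k := k) τ F
  rw [h] at this; simp at this

theorem sgn_union {τ G : Finset (Fin n)} {v : Fin n} (hd : Disjoint G τ) (hv : v ∉ G) (hv' : v ∉ τ) :
    sgn k (insert v (G ∪ τ)) v = sgn k (insert v G) v * sgn k τ v := by
  unfold sgn
  rw [← pow_add, Finset.filter_insert, if_neg (lt_irrefl v), Finset.filter_insert, if_neg (lt_irrefl v),
    Finset.filter_union, Finset.card_union_of_disjoint]
  exact Finset.disjoint_filter_filter hd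

theorem bdr_twist {τ : Finset (Fin n)} (z z' : Finset (Fin n) → k)
    (h1 : ∀ F, Disjoint F τ → z' F = epsS k τ F * z (F ∪ τ)) (h2 : ∀ F, ¬ Disjoint F τ → z' F = 0)
    (G : Finset (Fin n)) (hG : Disjoint G τ) : bdr z' G = epsS k τ G * bdr z (G ∪ τ) := by
  classical
  unfold bdr
  rw [Finset.mul_sum]
  rw [← Finset.sum_subset (s₁ := Finset.univ.filter (fun v => v ∉ G ∪ τ)) (s₂ := Finset.univ.filter (fun v => v ∉ G))]
  · refine Finset.sum_congr rfl fun v hv => ?_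
    simp only [Finset.mem_filter, Finset.mem_univ, true_and, Finset.mem_union, not_or] at hv
    rw [h1 _ (by simp [hv.2, hG]), sgn_union hG hv.1 hv.2, Finset.insert_union]
    have : epsS k τ (insert v G) = sgn k τ v * epsS k τ G := by
      unfold epsS; rw [Finset.prod_insert hv.1]
    rw [this]; ring
  · intro v; simp; tauto
  · intro v hv hv'
    simp only [Finset.mem_filter, Finset.mem_univ, true_and, Finset.mem_union, not_or] at hv hv'
    have : v ∈ τ := by by_contra h; exact hv' ⟨hv, h⟩
    rw [h2, mul_zero]
    simp [this]

theorem Z_onedim {Δ : SC n} (hM : Δ.IsHomologyManifold k) {τ : Finset (Fin n)} (hτ : τ ∈ Δ.faces)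
    (hne : τ ≠ ∅) (hlt : τ.card < Δ.faces.sup Finset.card) :
    ∃ o : Finset (Fin n) → k, isZ Δ (Δ.faces.sup Finset.card) τ o ∧ (∃ F, o F ≠ 0) ∧
      ∀ z, isZ Δ (Δ.faces.sup Finset.card) τ z → ∃ c : k, ∀ F, z F = c * o F := by
  classical
  set d := Δ.faces.sup Finset.card with hd
  obtain ⟨e, he⟩ : ∃ e, d = τ.card + (e + 1) := ⟨d - τ.card - 1, by omega⟩
  have hcard : ∀ F ∈ (Δ.link τ hτ).faces, F.card ≤ e + 1 := by
    intro F hF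
    rw [mem_link] at hF
    have := Finset.le_sup (f := Finset.card) hF.2
    rw [Finset.card_union_of_disjoint hF.1] at this
    omega
  have hdim : (e : ℤ) = (Δ.link τ hτ).dim := by
    unfold SC.dim
    have h1 : (Δ.link τ hτ).faces.sup Finset.card = e + 1 := by
      apply le_antisymm
      · exact Finset.sup_le hcard
      · obtain ⟨F, hF, hF1, hF2⟩ := purity hM hτ
        have : F \ τ ∈ (Δ.link τ hτ).faces := by
          rw [mem_link]
          exact ⟨Finset.sdiff_disjoint, by rwa [Finset.sdiff_union_of_subset hF1]⟩
        refine le_trans ?_ (Finset.le_sup (f := Finset.card) this)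
        rw [Finset.card_sdiff_of_subset hF1]; omega
    rw [h1]; push_cast; ring
  obtain ⟨o', ho1, ho2, ⟨F0, hF0⟩, ho3⟩ := top_hom (k := k) (Δ.link τ hτ) e hcard (((hM.2 τ hτ hne).1 e).1 hdim)
  have hsupp : ∀ F, τ ⊆ F → (F \ τ) ∪ τ = F := fun F h => Finset.sdiff_union_of_subset h
  let o : Finset (Fin n) → k := fun F => if τ ⊆ F then epsS k τ (F \ τ) * o' (F \ τ) else 0
  have hrel : ∀ F, Disjoint F τ → o' F = epsS k τ F * o (F ∪ τ) := by
    intro F hF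
    simp only [o]
    rw [if_pos Finset.subset_union_right, Finset.union_sdiff_right, Finset.sdiff_eq_self_of_disjoint hF,
      ← mul_assoc, epsS_sq, one_mul]
  have hrel2 : ∀ F, ¬ Disjoint F τ → o' F = 0 := by
    intro F hF
    by_contra h
    exact hF ((mem_link hτ F).1 (ho1 F h).1).1
  refine ⟨o, ⟨?_, ?_⟩, ?_, ?_⟩
  · intro F hF
    simp only [o] at hF
    split_ifs at hF with h
    · have h1 := ho1 _ (right_ne_zero_of_mul hF)
      have h2 := (mem_link hτ _).1 h1.1
      rw [hsupp F h] at h2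
      refine ⟨h2.2, ?_, h⟩
      have h3 := Finset.card_sdiff_of_subset h
      have h4 := Finset.card_le_card h
      omega
    · exact absurd rfl hF
  · intro G hG
    have := bdr_twist o o' hrel hrel2 (G \ τ) Finset.sdiff_disjoint
    rw [ho2, hsupp G hG] at this
    exact (mul_eq_zero.1 this.symm).resolve_left (epsS_ne _ _)
  · have hdj := ((mem_link hτ F0).1 (ho1 F0 hF0).1).1
    refine ⟨F0 ∪ τ, fun h => hF0 ?_⟩
    rw [hrel F0 hdj, h, mul_zero]
  · intro z hz
    let z' : Finset (Fin n) → k := fun F => if Disjoint F τ then epsS k τ F * z (F ∪ τ) else 0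
    have hz1 : ∀ F, Disjoint F τ → z' F = epsS k τ F * z (F ∪ τ) := fun F h => if_pos h
    have hz2 : ∀ F, ¬ Disjoint F τ → z' F = 0 := fun F h => if_neg h
    have hz3 : ∀ F, z' F ≠ 0 → F ∈ (Δ.link τ hτ).faces ∧ F.card = e + 1 := by
      intro F hF
      have hdj : Disjoint F τ := by by_contra h; exact hF (hz2 F h)
      rw [hz1 F hdj] at hF
      have h1 := hz.1 _ (right_ne_zero_of_mul hF)
      refine ⟨(mem_link hτ F).2 ⟨hdj, h1.1⟩, ?_⟩
      have := h1.2.1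
      rw [Finset.card_union_of_disjoint hdj] at this
      omega
    obtain ⟨c, hc⟩ := ho3 z' hz3 (by
      intro G
      by_cases hG : Disjoint G τ
      · rw [bdr_twist z z' hz1 hz2 G hG, hz.2 _ Finset.subset_union_right, mul_zero]
      · refine Finset.sum_eq_zero fun v _ => ?_
        rw [hz2, mul_zero]
        intro h
        exact hG (Finset.disjoint_of_subset_left (Finset.subset_insert _ _) h))
    refine ⟨c, fun F => ?_⟩
    by_cases h : τ ⊆ F
    · have h1 := hc (F \ τ)
      rw [hz1 _ Finset.sdiff_disjoint, hsupp F h] at h1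
      have h2 := hrel (F \ τ) Finset.sdiff_disjoint
      rw [hsupp F h] at h2
      rw [h2] at h1
      have h3 := epsS_ne (k := k) τ (F \ τ)
      apply mul_left_cancel₀ h3
      rw [h1]; ring
    · have h1 : z F = 0 := by by_contra h'; exact h (hz.1 F h').2.2
      rw [h1]
      simp only [o]
      rw [if_neg h, mul_zero]

theorem Z_full {Δ : SC n} (hM : Δ.IsHomologyManifold k) (m : ℕ) : ∀ τ ∈ Δ.faces, τ ≠ ∅ → 
    Δ.faces.sup Finset.card - τ.card ≤ m →
    ∃ o : Finset (Fin n) → k, isZ Δ (Δ.faces.sup Finset.card) τ o ∧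
      (∀ F ∈ Δ.faces, F.card = Δ.faces.sup Finset.card → τ ⊆ F → o F ≠ 0) ∧
      ∀ z, isZ Δ (Δ.faces.sup Finset.card) τ z → ∃ c : k, ∀ F, z F = c * o F := by
  classical
  set d := Δ.faces.sup Finset.card with hd
  have hcd : ∀ F ∈ Δ.faces, F.card ≤ d := fun F hF => Finset.le_sup (f := Finset.card) hF
  -- cycles for non-minimal sets are automatic when |τ| + 1 ≥ d
  have auto : ∀ (z : Finset (Fin n) → k), (∀ F, z F ≠ 0 → F.card = d) → ∀ G, d ≤ G.card → bdr z G = 0 := by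
    intro z hz G hG
    refine Finset.sum_eq_zero fun v hv => ?_
    simp only [Finset.mem_filter, Finset.mem_univ, true_and] at hv
    by_contra h
    have := hz _ (right_ne_zero_of_mul h)
    rw [Finset.card_insert_of_notMem hv] at this
    omega
  have base : ∀ τ ∈ Δ.faces, τ.card = d → ∃ o : Finset (Fin n) → k, isZ Δ d τ o ∧
      (∀ F ∈ Δ.faces, F.card = d → τ ⊆ F → o F ≠ 0) ∧ ∀ z, isZ Δ d τ z → ∃ c : k, ∀ F, z F = c * o F := by
    intro τ hτ hc
    refine ⟨fun F => if F = τ then 1 else 0, ⟨?_, ?_⟩, ?_, ?_⟩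
    · intro F hF
      have : F = τ := by by_contra h; exact hF (if_neg h)
      subst this; exact ⟨hτ, hc, subset_rfl⟩
    · intro G hG
      apply auto
      · intro F hF
        have : F = τ := by by_contra h; exact hF (if_neg h)
        subst this; exact hc
      · have := Finset.card_le_card hG; omega
    · intro F hF hF1 hF2
      have : F = τ := (Finset.eq_of_subset_of_card_le hF2 (by omega)).symm
      simp [this]
    · intro z hz
      refine ⟨z τ, fun F => ?_⟩
      by_cases h : F = τ
      · simp [h]
      · have : z F = 0 := by
          by_contra h'
          have h1 := hz.1 F h'
          exact h (Finset.eq_of_subset_of_card_le h1.2.2 (by omega)).symm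
        simp [h, this]
  induction m with
  | zero =>
    intro τ hτ _ hc
    exact base τ hτ (by have := hcd τ hτ; omega)
  | succ m ih =>
    intro τ hτ hne hc
    rcases (hcd τ hτ).eq_or_lt with h | hlt
    · exact base τ hτ h
    obtain ⟨o, ho, ⟨F0, hF0⟩, huniq⟩ := Z_onedim hM hτ hne hlt
    refine ⟨o, ho, ?_, huniq⟩
    intro F hF hFc hτF
    have hF0' := ho.1 F0 hF0
    have hex : ∀ G, τ ⊆ G → G.card = d → ∃ u ∈ G, u ∉ τ := by
      intro G h1 h2
      by_contra h
      push Not at h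
      have := Finset.card_le_card h
      omega
    obtain ⟨u, hu, huτ⟩ := hex F0 hF0'.2.2 hF0'.2.1
    obtain ⟨w, hw, hwτ⟩ := hex F hτF hFc
    by_cases hbig : τ.card + 2 ≤ d
    · -- dichotomy
      have hdich : ∀ a, a ∉ τ → insert a τ ∈ Δ.faces → (∃ G, insert a τ ⊆ G ∧ o G ≠ 0) →
          ∀ G ∈ Δ.faces, G.card = d → insert a τ ⊆ G → o G ≠ 0 := by
        rintro a ha ha' ⟨G0, hG0, hG0'⟩ G hG hGc hGs
        obtain ⟨oa, hoa1, hoa2, hoa3⟩ := ih (insert a τ) ha' (Finset.insert_ne_empty _ _) (by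
          rw [Finset.card_insert_of_notMem ha]; omega)
        obtain ⟨c, hc⟩ := hoa3 (fun F => if insert a τ ⊆ F then o F else 0) ⟨by
            intro F hF
            beta_reduce at hF
            split_ifs at hF with h
            · have := ho.1 F hF
              exact ⟨this.1, this.2.1, h⟩
            · exact absurd rfl hF, by
            intro G hG
            refine Eq.trans ?_ (ho.2 G ((Finset.subset_insert _ _).trans hG))
            refine Finset.sum_congr rfl fun v _ => ?_
            beta_reduce
            rw [if_pos (hG.trans (Finset.subset_insert _ _))]⟩
        have h1 := hc G0
        rw [if_pos hG0] at h1
        have hc0 : c ≠ 0 := by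
          rintro rfl; rw [zero_mul] at h1; exact hG0' h1
        have h2 := hc G
        rw [if_pos hGs] at h2
        rw [h2]
        exact mul_ne_zero hc0 (hoa2 G hG hGc hGs)
      have hpath := link_conn hM hτ ⟨F, hF, hτF, by omega⟩ huτ hwτ
        (Δ.down_closed hF0'.1 (Finset.insert_subset hu hF0'.2.2))
        (Δ.down_closed hF (Finset.insert_subset hw hτF))
      have step : ∀ w, Relation.ReflTransGen (fun a b => a ∉ τ ∧ b ∉ τ ∧ insert a (insert b τ) ∈ Δ.faces) u w →
          ∃ G, insert w τ ⊆ G ∧ o G ≠ 0 := by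
        intro w hw
        induction hw with
        | refl => exact ⟨F0, Finset.insert_subset hu hF0'.2.2, hF0⟩
        | @tail a b _ hab ihp =>
          obtain ⟨G, hG, hG1, hG2⟩ := purity hM hab.2.2
          refine ⟨G, (Finset.subset_insert _ _).trans hG1, ?_⟩
          have hsub : insert a τ ⊆ G := by
            refine Finset.Subset.trans ?_ hG1
            exact Finset.insert_subset_insert _ (Finset.subset_insert _ _)
          exact hdich a hab.1 (Δ.down_closed hG hsub) ihp G hG hG2 hsub
      exact hdich w hwτ (Δ.down_closed hF (Finset.insert_subset hw hτF)) (step w hpath) F hF hFc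
        (Finset.insert_subset hw hτF)
    · have hcτ : τ.card + 1 = d := by omega
      intro hzero
      have hFw : F = insert w τ := (Finset.eq_of_subset_of_card_le (Finset.insert_subset hw hτF) (by
        rw [Finset.card_insert_of_notMem hwτ]; omega)).symm
      have hF0u : F0 = insert u τ := (Finset.eq_of_subset_of_card_le (Finset.insert_subset hu hF0'.2.2) (by
        rw [Finset.card_insert_of_notMem huτ]; omega)).symm
      have huw : u ≠ w := by
        rintro rfl
        rw [hFw, ← hF0u] at hzero
        exact hF0 hzero
      have hins : ∀ a b, a ∉ τ → b ∉ τ → insert a τ = insert b τ → a = b := by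
        intro a b ha hb h
        have : a ∈ insert b τ := by rw [← h]; simp
        simpa [ha] using this
      let z : Finset (Fin n) → k := fun G => if G = insert w τ then sgn k (insert w τ) w
        else if G = insert u τ then - sgn k (insert u τ) u else 0
      have hz1 : ∀ G, z G ≠ 0 → G ∈ Δ.faces ∧ G.card = d ∧ τ ⊆ G := by
        intro G hG
        simp only [z] at hG
        split_ifs at hG with h1 h2
        · rw [h1, ← hFw]; exact ⟨hF, hFc, hτF⟩
        · rw [h2, ← hF0u]; exact hF0'
        · exact absurd rfl hG
      have hz : isZ Δ d τ z := by
        refine ⟨hz1, ?_⟩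
        intro G hG
        rcases eq_or_ne G τ with rfl | hne'
        · unfold bdr
          rw [← Finset.sum_subset (s₁ := {w, u})]
          · rw [Finset.sum_pair huw.symm]
            have e1 : z (insert w G) = sgn k (insert w G) w := if_pos rfl
            have e2 : z (insert u G) = - sgn k (insert u G) u :=
              (if_neg (fun h => huw (hins _ _ huτ hwτ h))).trans (if_pos rfl)
            rw [e1, e2]
            rw [mul_neg, sgn_sq, sgn_sq]; ring
          · intro v hv
            simp only [Finset.mem_insert, Finset.mem_singleton] at hv
            rcases hv with rfl | rfl <;> simp [hwτ, huτ]
          · intro v hv hv'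
            simp only [Finset.mem_insert, Finset.mem_singleton, not_or, Finset.mem_filter, Finset.mem_univ, true_and] at hv hv'
            simp only [z]
            rw [if_neg (fun h => hv'.1 (hins _ _ hv hwτ h)), if_neg (fun h => hv'.2 (hins _ _ hv huτ h)), mul_zero]
        · apply auto z (fun F hF => (hz1 F hF).2.1)
          have := Finset.card_lt_card (Finset.ssubset_iff_subset_ne.2 ⟨hG, hne'.symm⟩)
          omega
      obtain ⟨c, hc⟩ := huniq z hz
      have h1 := hc F
      rw [hzero, mul_zero] at h1
      simp only [z] at h1
      rw [if_pos hFw] at h1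
      exact sgn_ne _ _ h1

end Comb2


section Phi

variable {k : Type} [Field k] {n : ℕ}

/-- The submodule of cycles killed by the Stanley–Reisner ideal. -/
noncomputable def cW (k : Type) [Field k] (Δ : SC n) : Submodule (MvPolynomial (Fin n) k) (cQ k n) where
  carrier := {y | y ∈ cZm k n (Δ.faces.sup Finset.card) ∧ ∀ p ∈ srIdeal k Δ, p • y = 0}
  add_mem' := by
    rintro x y ⟨hx, hx'⟩ ⟨hy, hy'⟩
    exact ⟨Submodule.add_mem _ hx hy, fun p hp => by rw [smul_add, hx' p hp, hy' p hp, add_zero]⟩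
  zero_mem' := ⟨Submodule.zero_mem _, fun p _ => smul_zero p⟩
  smul_mem' := by
    rintro c x ⟨hx, hx'⟩
    exact ⟨Submodule.smul_mem _ _ hx, fun p hp => by rw [smul_comm, hx' p hp, smul_zero]⟩

theorem sr_gen {Δ : SC n} {σ : Finset (Fin n)} (h : σ ∉ Δ.faces) :
    (∏ i ∈ σ, MvPolynomial.X i : MvPolynomial (Fin n) k) ∈ srIdeal k Δ :=
  Ideal.subset_span ⟨σ, h, rfl⟩

theorem sum_single_apply (s : Finset (Fin n)) (j : Fin n) :
    (∑ i ∈ s, (Pi.single i 1 : Fin n → ℤ)) j = if j ∈ s then 1 else 0 := by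
  classical
  rw [Finset.sum_apply]
  simp [Pi.single_apply]

theorem cW_kill {Δ : SC n} {y : cQ k n} (hy : y ∈ cW k Δ) {σ F : Finset (Fin n)} (h : σ ∉ Δ.faces)
    {a : Fin n → ℤ} (hg : ∀ i, i ∉ F → a i + (if i ∈ σ then 1 else 0) < 0) : cfQ F a y = 0 := by
  classical
  have h1 := hy.2 _ (sr_gen (k := k) h)
  have hg' : goodDeg F (a + ∑ i ∈ σ, Pi.single i 1) := by
    intro i hi
    rw [Pi.add_apply, sum_single_apply]
    exact hg i hi
  have h2 := cfQ_xF σ F (a + ∑ i ∈ σ, Pi.single i 1) y hg'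
  rw [h1, map_zero, add_sub_cancel_right] at h2
  exact h2.symm

theorem cW_card {Δ : SC n} {y : cQ k n} (hy : y ∈ cW k Δ) {F : Finset (Fin n)} {a : Fin n → ℤ}
    (h : cfQ F a y ≠ 0) : F.card = Δ.faces.sup Finset.card := by
  by_contra hc
  exact h (hy.1.1 F a hc)

theorem cW_good {y : cQ k n} {F : Finset (Fin n)} {a : Fin n → ℤ}
    (h : cfQ F a y ≠ 0) : goodDeg F a := by
  by_contra hc
  exact h (cfQ_bad hc y)

theorem cW_face {Δ : SC n} {y : cQ k n} (hy : y ∈ cW k Δ) {F : Finset (Fin n)} {a : Fin n → ℤ}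
    (h : cfQ F a y ≠ 0) : F ∈ Δ.faces := by
  classical
  by_contra hF
  refine h (cW_kill hy hF fun i hi => ?_)
  rw [if_neg hi, add_zero]
  exact cW_good h i hi

theorem cW_off {Δ : SC n} {y : cQ k n} (hy : y ∈ cW k Δ) {F : Finset (Fin n)} {a : Fin n → ℤ}
    (h : cfQ F a y ≠ 0) {i : Fin n} (hi : i ∉ F) : a i = -1 := by
  classical
  by_contra hne
  have hg := cW_good h
  have hlt := hg i hi
  refine h (cW_kill (σ := insert i F) hy ?_ fun j hj => ?_)
  · intro hF
    have h1 := Finset.le_sup (f := Finset.card) hF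
    rw [Finset.card_insert_of_notMem hi, cW_card hy h] at h1
    omega
  · by_cases hji : j = i
    · subst hji; rw [if_pos (Finset.mem_insert_self _ _)]; omega
    · rw [if_neg (by simp [hji, hj]), add_zero]; exact hg j hj

theorem cW_bdr {Δ : SC n} {y : cQ k n} (hy : y ∈ cW k Δ) {G : Finset (Fin n)} {a : Fin n → ℤ}
    (hg : goodDeg G a) : bdr (fun F => cfQ F a y) G = 0 := by
  have h1 : cD k n y = 0 := hy.1.2
  have h2 := cfQ_D G a y
  rw [h1, map_zero, if_pos hg] at h2
  exact h2.symm

theorem cW_ge {Δ : SC n} {y : cQ k n} (hy : y ∈ cW k Δ) {F : Finset (Fin n)} {a : Fin n → ℤ}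
    (h : cfQ F a y ≠ 0) (i : Fin n) : -1 ≤ a i := by
  classical
  by_cases hi : i ∈ F
  swap
  · rw [cW_off hy h hi]
  by_contra hlt
  have hg : goodDeg (F.erase i) a := by
    intro j hj
    by_cases hji : j = i
    · subst hji; omega
    · exact cW_good h j (fun h' => hj (Finset.mem_erase.2 ⟨hji, h'⟩))
  have h1 := cW_bdr hy hg
  unfold bdr at h1
  rw [Finset.sum_eq_single i] at h1
  · rw [Finset.insert_erase hi] at h1
    exact (mul_ne_zero (sgn_ne _ _) h) h1
  · intro v hv hvi
    by_cases h0 : cfQ (insert v (F.erase i)) a y = 0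
    · change _ * cfQ (insert v (F.erase i)) a y = 0
      rw [h0, mul_zero]
    · have := cW_off hy h0 (i := i) (by simp [hvi.symm])
      omega
  · intro h'; exact absurd (by simp) h'

theorem cW_isZ {Δ : SC n} {y : cQ k n} (hy : y ∈ cW k Δ) {σ : Finset (Fin n)} {a : Fin n → ℤ}
    (hg : goodDeg σ a) : isZ Δ (Δ.faces.sup Finset.card) σ (fun F => if σ ⊆ F then cfQ F a y else 0) := by
  classical
  constructor
  · intro F hF
    beta_reduce at hF
    split_ifs at hF with h
    · exact ⟨cW_face hy hF, cW_card hy hF, h⟩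
    · exact absurd rfl hF
  · intro G hG
    refine Eq.trans ?_ (cW_bdr hy (hg.mono hG))
    refine Finset.sum_congr rfl fun v _ => ?_
    beta_reduce
    rw [if_pos (hG.trans (Finset.subset_insert _ _))]

theorem isZ_restrict {Δ : SC n} {d : ℕ} {τ σ : Finset (Fin n)} {o : Finset (Fin n) → k} (ho : isZ Δ d τ o)
    (h : τ ⊆ σ) : isZ Δ d σ (fun F => if σ ⊆ F then o F else 0) := by
  classical
  constructor
  · intro F hF
    beta_reduce at hF
    split_ifs at hF with h
    · exact ⟨(ho.1 F hF).1, (ho.1 F hF).2.1, h⟩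
    · exact absurd rfl hF
  · intro G hG
    refine Eq.trans ?_ (ho.2 G (h.trans hG))
    refine Finset.sum_congr rfl fun v _ => ?_
    beta_reduce
    rw [if_pos (hG.trans (Finset.subset_insert _ _))]

/-- proportionality of the coefficients of `y` and of the local orientation at `v`. -/
theorem cW_prop {Δ : SC n} (hM : Δ.IsHomologyManifold k) {y : cQ k n} (hy : y ∈ cW k Δ) {v : Fin n}
    {o : Finset (Fin n) → k} (ho : isZ Δ (Δ.faces.sup Finset.card) {v} o)
    (ho' : ∀ F ∈ Δ.faces, F.card = Δ.faces.sup Finset.card → {v} ⊆ F → o F ≠ 0)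
    {σ : Finset (Fin n)} (hσ : σ ∈ Δ.faces) (hv : v ∈ σ) {a : Fin n → ℤ} (hg : goodDeg σ a) :
    ∃ c : k, ∀ F, σ ⊆ F → cfQ F a y = c * o F := by
  classical
  obtain ⟨ot, -, -, hot⟩ := Z_full hM _ σ hσ (Finset.ne_empty_of_mem hv) le_rfl
  have hvσ : {v} ⊆ σ := by simpa using hv
  obtain ⟨c1, hc1⟩ := hot _ (cW_isZ hy hg)
  obtain ⟨c2, hc2⟩ := hot _ (isZ_restrict ho hvσ)
  obtain ⟨F0, hF0, hF0s, hF0c⟩ := purity hM hσ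
  have h2 := hc2 F0
  beta_reduce at h2
  rw [if_pos hF0s] at h2
  have hc2' : c2 ≠ 0 := by
    rintro rfl
    rw [zero_mul] at h2
    exact ho' F0 hF0 hF0c (hvσ.trans hF0s) h2
  refine ⟨c1 / c2, fun F hF => ?_⟩
  have h1 := hc1 F
  have h3 := hc2 F
  beta_reduce at h1 h3
  rw [if_pos hF] at h1 h3
  rw [h1, h3]
  field_simp

theorem mk_eq_of_coeff {Δ : SC n} {p q : MvPolynomial (Fin n) k}
    (h : ∀ m : Fin n →₀ ℕ, m.support ∈ Δ.faces → p.coeff m = q.coeff m) :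
    Ideal.Quotient.mk (srIdeal k Δ) p = Ideal.Quotient.mk (srIdeal k Δ) q := by
  classical
  rw [Ideal.Quotient.eq, MvPolynomial.as_sum (p - q)]
  refine Ideal.sum_mem _ fun m hm => ?_
  have hm' : m.support ∉ Δ.faces := by
    intro h'
    rw [MvPolynomial.mem_support_iff, MvPolynomial.coeff_sub, h m h', sub_self] at hm
    exact hm rfl
  rw [MvPolynomial.monomial_eq, Finsupp.prod]
  refine Ideal.mul_mem_left _ _ ?_
  refine Ideal.mem_of_dvd _ ?_ (sr_gen hm')
  exact Finset.prod_dvd_prod_of_dvd _ _ fun i hi => dvd_pow_self _ (Finsupp.mem_support_iff.1 hi)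

end Phi


section Phi2

variable {k : Type} [Field k] {n : ℕ}

/-- shifted degree -/
def shD (v : Fin n) (m : Fin n →₀ ℕ) : Fin n → ℤ := expZ m - Pi.single v 1 - 1

theorem shD_apply (v : Fin n) (m : Fin n →₀ ℕ) (i : Fin n) :
    shD v m i = (m i : ℤ) - (if i = v then 1 else 0) - 1 := by
  simp [shD, expZ, Pi.single_apply]

theorem shD_inj (v : Fin n) : Function.Injective (shD v) := by
  intro m m' h
  ext i
  have := congrFun h i
  rw [shD_apply, shD_apply] at this
  omega

theorem shD_good {v : Fin n} {m : Fin n →₀ ℕ} (hv : v ∈ m.support) : goodDeg m.support (shD v m) := by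
  intro i hi
  have h1 : i ≠ v := fun h => hi (h ▸ hv)
  have h2 : m i = 0 := by simpa using hi
  rw [shD_apply, h2, if_neg h1]; simp

theorem smul_mk (Δ : SC n) (p q : MvPolynomial (Fin n) k) :
    p • (Ideal.Quotient.mk (srIdeal k Δ) q : SRRing k Δ) = Ideal.Quotient.mk (srIdeal k Δ) (p * q) := rfl

theorem exists_phi {Δ : SC n} (hM : Δ.IsHomologyManifold k) {v : Fin n}
    {o : Finset (Fin n) → k} (ho : isZ Δ (Δ.faces.sup Finset.card) {v} o)
    (ho' : ∀ F ∈ Δ.faces, F.card = Δ.faces.sup Finset.card → {v} ⊆ F → o F ≠ 0) :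
    ∃ φ : cW k Δ →ₗ[MvPolynomial (Fin n) k] SRRing k Δ, ∀ y : cW k Δ,
      ∃ p : MvPolynomial (Fin n) k, φ y = Ideal.Quotient.mk (srIdeal k Δ) p ∧
        (∀ m, v ∉ m.support → p.coeff m = 0) ∧
        ∀ m : Fin n →₀ ℕ, v ∈ m.support → m.support ∈ Δ.faces → ∀ F, m.support ⊆ F →
          cfQ F (shD v m) y.1 = p.coeff m * o F := by
  classical
  have key : ∀ y : cW k Δ, ∃ p : MvPolynomial (Fin n) k, 
        (∀ m, v ∉ m.support → p.coeff m = 0) ∧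
        ∀ m : Fin n →₀ ℕ, v ∈ m.support → m.support ∈ Δ.faces → ∀ F, m.support ⊆ F →
          cfQ F (shD v m) y.1 = p.coeff m * o F := by
    intro y
    have h1 : ∀ m : Fin n →₀ ℕ, ∃ c : k, (c ≠ 0 → ∃ F, cfQ F (shD v m) y.1 ≠ 0) ∧ 
        (v ∉ m.support → c = 0) ∧ (v ∈ m.support → m.support ∈ Δ.faces → ∀ F, m.support ⊆ F →
          cfQ F (shD v m) y.1 = c * o F) := by
      intro m
      by_cases hm : v ∈ m.support ∧ m.support ∈ Δ.faces
      · obtain ⟨c, hc⟩ := cW_prop hM y.2 ho ho' hm.2 hm.1 (shD_good hm.1)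
        refine ⟨c, fun hc0 => ?_, fun h => absurd hm.1 h, fun _ _ => hc⟩
        obtain ⟨F, hF, hs, hFc⟩ := purity hM hm.2
        refine ⟨F, ?_⟩
        rw [hc F hs]
        exact mul_ne_zero hc0 (ho' F hF hFc (by simpa using hs hm.1))
      · exact ⟨0, fun h => absurd rfl h, fun _ => rfl, fun h1 h2 => absurd ⟨h1, h2⟩ hm⟩
    choose c hc1 hc2 hc3 using h1
    obtain ⟨p, hp⟩ := exists_poly c (by
      have hfin : (⋃ F : Finset (Fin n), (shD v) ⁻¹' {a | cfQ F a y.1 ≠ 0}).Finite :=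
        Set.finite_iUnion fun F => (cQ_finite y.1 F).preimage (shD_inj v).injOn
      refine hfin.subset fun m hm => ?_
      obtain ⟨F, hF⟩ := hc1 m hm
      exact Set.mem_iUnion.2 ⟨F, hF⟩)
    refine ⟨p, fun m hm => ?_, fun m h1 h2 F hF => ?_⟩
    · rw [hp]; exact hc2 m hm
    · rw [hp]; exact hc3 m h1 h2 F hF
  choose P hP1 hP2 using key
  -- uniqueness criterion
  have uniq : ∀ (y : cW k Δ) (q : MvPolynomial (Fin n) k), (∀ m, m.support ∈ Δ.faces → v ∉ m.support → q.coeff m = 0) →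
      (∀ m : Fin n →₀ ℕ, v ∈ m.support → m.support ∈ Δ.faces → ∀ F, m.support ⊆ F →
          cfQ F (shD v m) y.1 = q.coeff m * o F) →
      Ideal.Quotient.mk (srIdeal k Δ) (P y) = Ideal.Quotient.mk (srIdeal k Δ) q := by
    intro y q hq1 hq2
    refine mk_eq_of_coeff fun m hm => ?_
    by_cases hv : v ∈ m.support
    · obtain ⟨F, hF, hs, hFc⟩ := purity hM hm
      have h0 := ho' F hF hFc (by simpa using hs hv)
      exact mul_right_cancel₀ h0 ((hP2 y m hv hm F hs).symm.trans (hq2 m hv hm F hs))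
    · rw [hP1 y m hv, hq1 m hm hv]
  obtain ⟨φ, hφ⟩ := exists_lin (M := cW k Δ) (N := SRRing k Δ) (fun y => Ideal.Quotient.mk (srIdeal k Δ) (P y)) (by
      intro x y
      change _ = Ideal.Quotient.mk (srIdeal k Δ) (P x) + Ideal.Quotient.mk (srIdeal k Δ) (P y)
      rw [← map_add]
      refine uniq _ _ ?_ ?_
      · intro m _ hm
        rw [MvPolynomial.coeff_add, hP1 x m hm, hP1 y m hm, add_zero]
      · intro m h1 h2 F hF
        rw [MvPolynomial.coeff_add, add_mul, ← hP2 x m h1 h2 F hF, ← hP2 y m h1 h2 F hF]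
        exact map_add _ _ _) (by
      intro c y
      refine Eq.trans ?_ (smul_mk Δ (MvPolynomial.C (σ := Fin n) c) (P y)).symm
      refine uniq _ _ ?_ ?_
      · intro m _ hm
        rw [MvPolynomial.coeff_C_mul, hP1 y m hm, mul_zero]
      · intro m h1 h2 F hF
        rw [MvPolynomial.coeff_C_mul, mul_assoc, ← hP2 y m h1 h2 F hF]
        exact cfQ_C _ _ _ _) (by
      intro i y
      change _ = Ideal.Quotient.mk (srIdeal k Δ) (MvPolynomial.X (R := k) i * P y)
      refine uniq _ _ ?_ ?_
      · intro m _ hm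
        rw [MvPolynomial.coeff_X_mul']
        split_ifs with hi
        · refine hP1 y _ ?_
          simp at hm ⊢
          simp [hm]
        · rfl
      · intro m h1 h2 F hF
        refine (cfQ_X F (shD v m) i y.1).trans ?_
        rw [if_pos ((shD_good h1).mono hF), MvPolynomial.coeff_X_mul']
        have hlow : (shD v m - Pi.single i 1 : Fin n → ℤ) i < -1 → cfQ F (shD v m - Pi.single i 1) y.1 = 0 := by
          intro hlt
          by_contra h0
          have := cW_ge y.2 h0 i
          omega
        have e1 : (shD v m - Pi.single i 1 : Fin n → ℤ) i = (m i : ℤ) - (if i = v then 1 else 0) - 1 - 1 := by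
          rw [Pi.sub_apply, shD_apply]; simp
        split_ifs with hi
        · by_cases hv' : v ∈ (m - Finsupp.single i 1).support
          · have hsub : (m - Finsupp.single i 1).support ⊆ m.support := by
              intro j hj
              rw [Finsupp.mem_support_iff] at hj ⊢
              intro h0
              apply hj
              simp [h0]
            rw [← hP2 y _ hv' (Δ.down_closed h2 hsub) F (hsub.trans hF)]
            congr 1
            have hi' : m i ≠ 0 := Finsupp.mem_support_iff.1 hi
            have : shD v m - Pi.single i 1 = shD v (m - Finsupp.single i 1) := by
              funext j
              rw [Pi.sub_apply, shD_apply, shD_apply, Finsupp.tsub_apply]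
              by_cases hji : j = i
              · subst hji
                simp only [Pi.single_eq_same, Finsupp.single_eq_same]
                omega
              · rw [Pi.single_eq_of_ne hji, Finsupp.single_eq_of_ne hji]; simp
            rw [this]
          · rw [hP1 y _ hv', zero_mul]
            apply hlow
            have hm1 : m v ≠ 0 := Finsupp.mem_support_iff.1 h1
            have hm2 : m v - (Finsupp.single i 1 : Fin n →₀ ℕ) v = 0 := by
              simpa [Finsupp.mem_support_iff] using hv'
            have hiv : i = v := by
              by_contra hne
              rw [Finsupp.single_eq_of_ne (Ne.symm hne)] at hm2
              omega
            subst hiv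
            rw [Finsupp.single_eq_same] at hm2
            rw [e1, if_pos rfl]
            omega
        · rw [zero_mul]
          apply hlow
          have hmi : m i = 0 := by simpa using hi
          rw [e1, hmi]
          split_ifs <;> simp)
  refine ⟨φ, fun y => ⟨P y, hφ y, hP1 y, hP2 y⟩⟩

/-- the element attached to a vertex -/
theorem exists_yw {Δ : SC n} {w : Fin n}
    {o : Finset (Fin n) → k} (ho : isZ Δ (Δ.faces.sup Finset.card) {w} o) :
    ∃ y : cW k Δ, ∀ F a, cfQ F a y.1 = if a = Pi.single w 1 - 1 then o F else 0 := by
  classical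
  have hval : ∀ i, i ≠ w → (Pi.single w 1 - 1 : Fin n → ℤ) i = -1 := by
    intro i hi; simp [hi]
  have hvalw : (Pi.single w 1 - 1 : Fin n → ℤ) w = 0 := by simp
  obtain ⟨y, hy⟩ := cQ_exists' (n := n) (fun F a => if a = Pi.single w 1 - 1 then o F else 0) (by
      intro F
      refine (Set.finite_singleton (Pi.single w 1 - 1 : Fin n → ℤ)).subset ?_
      intro a ha
      by_contra hne
      exact ha (if_neg hne)) (by
      intro F a hg
      split_ifs with h
      · by_contra h0
        apply hg
        intro i hi
        have hw : w ∈ F := by simpa using (ho.1 F h0).2.2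
        rw [h, hval i (fun h' => hi (h' ▸ hw))]; simp
      · rfl)
  have hcyc : cD k n y = 0 := by
    refine cQ_ext fun G a hg => ?_
    rw [cfQ_D, if_pos hg, map_zero]
    by_cases ha : a = Pi.single w 1 - 1
    · have hw : w ∈ G := by
        by_contra hw
        have := hg w hw
        rw [ha, hvalw] at this
        omega
      refine Eq.trans ?_ (ho.2 G (by simpa using hw))
      refine Finset.sum_congr rfl fun v _ => ?_
      rw [hy, if_pos ha]
    · refine Finset.sum_eq_zero fun v _ => ?_
      rw [hy, if_neg ha, mul_zero]
  have hcard : y ∈ cQm k n (Δ.faces.sup Finset.card) := by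
    intro F a hF
    rw [hy]
    split_ifs with h
    · by_contra h0
      exact hF (ho.1 F h0).2.1
    · rfl
  have hkill : ∀ p ∈ srIdeal k Δ, p • y = 0 := by
    intro p hp
    refine Submodule.span_induction (p := fun p _ => p • y = 0) ?_ ?_ ?_ ?_ hp
    · rintro _ ⟨σ, hσ, rfl⟩
      refine cQ_ext fun F a hg => ?_
      rw [cfQ_xF σ F a y hg, hy, map_zero]
      split_ifs with h
      · by_contra h0
        have hF := ho.1 F h0
        have hns : ¬ σ ⊆ F := fun hs => hσ (Δ.down_closed hF.1 hs)
        obtain ⟨i, hi, hiF⟩ := Finset.not_subset.1 hns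
        have hw : w ∈ F := by simpa using hF.2.2
        have h1 := congrFun h i
        rw [hval i (fun h' => hiF (h' ▸ hw)), Pi.sub_apply, sum_single_apply, if_pos hi] at h1
        have := hg i hiF
        omega
      · rfl
    · exact zero_smul _ _
    · intro a b _ _ ha hb
      rw [add_smul, ha, hb, add_zero]
    · intro a b _ hb
      rw [smul_eq_mul, mul_smul, hb, smul_zero]
  exact ⟨⟨y, ⟨hcard, hcyc⟩, hkill⟩, hy⟩

theorem exists_hit {Δ : SC n} (hM : Δ.IsHomologyManifold k) {v w : Fin n} (hvw : {v, w} ∈ Δ.faces) :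
    ∃ (φ : cW k Δ →ₗ[MvPolynomial (Fin n) k] SRRing k Δ) (y : cW k Δ),
      φ y = Ideal.Quotient.mk (srIdeal k Δ) (MvPolynomial.X v * MvPolynomial.X w) := by
  classical
  have hv : {v} ∈ Δ.faces := Δ.down_closed hvw (by simp)
  have hw : {w} ∈ Δ.faces := Δ.down_closed hvw (by simp)
  obtain ⟨o, ho, ho', -⟩ := Z_full hM _ {v} hv (by simp) le_rfl
  obtain ⟨o2, ho2, ho2', -⟩ := Z_full hM _ {w} hw (by simp) le_rfl
  obtain ⟨φ, hφ⟩ := exists_phi hM ho ho'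
  obtain ⟨y, hy⟩ := exists_yw ho2
  obtain ⟨p, hp, hp1, hp2⟩ := hφ y
  let m0 : Fin n →₀ ℕ := Finsupp.single v 1 + Finsupp.single w 1
  have hm0 : ∀ j, m0 j = (if j = v then 1 else 0) + (if j = w then 1 else 0) := by
    intro j
    simp only [m0, Finsupp.add_apply, Finsupp.single_apply, eq_comm]
  have hsupp : m0.support = {v, w} := by
    ext j
    rw [Finsupp.mem_support_iff, hm0]
    simp only [Finset.mem_insert, Finset.mem_singleton]
    split_ifs <;> simp_all
  have hsh : ∀ m, shD v m = Pi.single w 1 - 1 ↔ m = m0 := by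
    intro m
    have e : shD v m0 = Pi.single w 1 - 1 := by
      funext j
      rw [shD_apply, hm0]
      simp only [Pi.sub_apply, Pi.single_apply, Pi.one_apply]
      push_cast
      ring
    rw [← e]
    exact (shD_inj v).eq_iff
  obtain ⟨F, hF, hs, hFc⟩ := purity hM hvw
  have h1 := hp2 m0 (by rw [hsupp]; simp) (by rw [hsupp]; exact hvw) F (by rw [hsupp]; exact hs)
  rw [hy, if_pos ((hsh m0).2 rfl)] at h1
  have hc0 : p.coeff m0 ≠ 0 := by
    intro h0
    rw [h0, zero_mul] at h1
    exact ho2' F hF hFc (by simpa using hs (by simp : w ∈ ({v, w} : Finset (Fin n)))) h1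
  refine ⟨φ, MvPolynomial.C (σ := Fin n) (p.coeff m0)⁻¹ • y, ?_⟩
  rw [map_smul, hp]
  change Ideal.Quotient.mk (srIdeal k Δ) (MvPolynomial.C (σ := Fin n) (p.coeff m0)⁻¹ * p) = _
  refine mk_eq_of_coeff fun m hm => ?_
  have hXX : (MvPolynomial.X v * MvPolynomial.X w : MvPolynomial (Fin n) k) = MvPolynomial.monomial m0 1 := by
    rw [MvPolynomial.X, MvPolynomial.X, MvPolynomial.monomial_mul, one_mul]
  rw [hXX, MvPolynomial.coeff_C_mul, MvPolynomial.coeff_monomial]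
  split_ifs with h
  · rw [← h]; exact inv_mul_cancel₀ hc0
  · have : p.coeff m = 0 := by
      by_cases hvm : v ∈ m.support
      · obtain ⟨F', hF', hs', hFc'⟩ := purity hM hm
        have h2 := hp2 m hvm hm F' hs'
        rw [hy, if_neg (fun h' => h ((hsh m).1 h').symm)] at h2
        rcases mul_eq_zero.1 h2.symm with h3 | h3
        · exact h3
        · exact absurd h3 (ho' F' hF' hFc' (by simpa using hs' hvm))
      · exact hp1 m hvm
    rw [this, mul_zero]

/-- Evaluation at one identifies homs with `cW`. -/
theorem hom_equiv (Δ : SC n) :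
    ∃ g : (SRRing k Δ →ₗ[MvPolynomial (Fin n) k] cZm k n (Δ.faces.sup Finset.card)) →ₗ[MvPolynomial (Fin n) k] cW k Δ,
      Function.Surjective g := by
  refine ⟨{ toFun := fun f => ⟨(f 1).1, (f 1).2, fun p hp => ?_⟩, map_add' := fun f g => rfl, map_smul' := fun c f => rfl }, ?_⟩
  · have h1 : p • f 1 = 0 := by
      rw [← map_smul]
      have : p • (1 : SRRing k Δ) = 0 := by
        change Ideal.Quotient.mk (srIdeal k Δ) (p * 1) = 0
        rw [mul_one]
        exact Ideal.Quotient.eq_zero_iff_mem.2 hp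
      rw [this, map_zero]
    exact congrArg Subtype.val h1
  · rintro ⟨y, hy, hk⟩
    let y' : cZm k n (Δ.faces.sup Finset.card) := ⟨y, hy⟩
    let f0 : SRRing k Δ →ₗ[MvPolynomial (Fin n) k] cZm k n (Δ.faces.sup Finset.card) :=
      Submodule.liftQ (srIdeal k Δ) (LinearMap.toSpanSingleton (MvPolynomial (Fin n) k) _ y') (by
        intro p hp
        rw [LinearMap.mem_ker, LinearMap.toSpanSingleton_apply]
        exact Subtype.ext (hk p hp))
    refine ⟨f0, Subtype.ext ?_⟩
    have : f0 1 = (1 : MvPolynomial (Fin n) k) • y' := rfl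
    change (f0 1).1 = y
    rw [this, one_smul]

end Phi2

set_option maxHeartbeats 1000000 in
set_option synthInstance.maxHeartbeats 1000000 in
/-- Let `Δ` be a non-`k`-orientable `k`-homology manifold and `R = k[Δ]`.
Then `tr(ω_R) ⊇ 𝔐²`. -/
theorem maxIdeal_sq_le_trace
    (k : Type) [Field k] {n : ℕ} (Δ : SC n)
    (hHM : Δ.IsHomologyManifold k) (hnonor : ¬ Δ.Orientable k)
    (ω : Type) [AddCommGroup ω] [Module (SRRing k Δ) ω]
    (hω : IsCanonicalModuleQ k (srIdeal k Δ) ω) :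
    srMax k Δ ^ 2 ≤ traceIdeal (SRRing k Δ) ω := by
  classical
  obtain ⟨-, d, hd, he⟩ := hω
  have hd' : d = Δ.faces.sup Finset.card := by
    have h := (krull_SR (k := k) Δ).symm.trans hd
    have h' : ((Δ.faces.sup Finset.card : ℕ) : WithBot ℕ∞) = (d : WithBot ℕ∞) := h
    exact_mod_cast h'.symm
  subst hd'
  letI : Module (MvPolynomial (Fin n) k) ω := Module.compHom ω (Ideal.Quotient.mk (srIdeal k Δ))
  obtain ⟨e⟩ := he
  obtain ⟨e2⟩ := ext_SR (k := k) Δ (Δ.faces.sup Finset.card)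
    (Finset.sup_le fun F _ => by simpa using Finset.card_le_univ F) (fun F hF => Finset.le_sup (f := Finset.card) hF)
  obtain ⟨g, hg⟩ := hom_equiv (k := k) Δ
  have main : ∀ v w : Fin n, Ideal.Quotient.mk (srIdeal k Δ) (MvPolynomial.X v * MvPolynomial.X w) ∈
      traceIdeal (SRRing k Δ) ω := by
    intro v w
    by_cases hvw : {v, w} ∈ Δ.faces
    · obtain ⟨φ, y, hy⟩ := exists_hit hHM hvw
      obtain ⟨f, rfl⟩ := hg y
      let ψ : ω →ₗ[MvPolynomial (Fin n) k] SRRing k Δ := φ ∘ₗ g ∘ₗ e2.toLinearMap ∘ₗ e.toLinearMap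
      let ψ' : ω →ₗ[SRRing k Δ] SRRing k Δ :=
        { toFun := ψ
          map_add' := fun a b => map_add ψ a b
          map_smul' := by
            intro r x
            obtain ⟨p, rfl⟩ := Ideal.Quotient.mk_surjective r
            exact map_smul ψ p x }
      refine (le_iSup (fun f : ω →ₗ[SRRing k Δ] SRRing k Δ => LinearMap.range f) ψ') ?_
      refine ⟨e.symm (e2.symm f), ?_⟩
      change φ (g (e2 (e (e.symm (e2.symm f))))) = _
      rw [LinearEquiv.apply_symm_apply, LinearEquiv.apply_symm_apply, hy]
    · have : Ideal.Quotient.mk (srIdeal k Δ) (MvPolynomial.X v * MvPolynomial.X w) = 0 := by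
        rw [Ideal.Quotient.eq_zero_iff_mem]
        refine Ideal.mem_of_dvd _ ?_ (sr_gen hvw)
        by_cases h : v = w
        · subst h; simp
        · rw [Finset.prod_pair h]
      rw [this]
      exact Submodule.zero_mem _
  rw [pow_two]
  unfold srMax quotMax
  rw [Ideal.span_mul_span', Ideal.span_le]
  rintro _ ⟨_, ⟨v, rfl⟩, _, ⟨w, rfl⟩, rfl⟩
  have := main v w
  rw [map_mul] at this
  exact this
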